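/- arXiv:math/0506363 — 2 statements merged into one kernel-verified Lean document; each statement's English description precedes it below -/
import Mathlib

section
/- For every integer d ≥ 2 there exists a connected simple graph X of bounded degree with polynomial growth of degree d (graph distance, counting measure) such that: (1) there is a sequence (A_n) of finite vertex sets with |A_n| → ∞ and |∂A_n| / |A_n|^{(d-1)/d} → 0 (so the profile of X is not strong); and (2) for every C ≥ 1 and a > 0 there is c > 0 such that every finite vertex set P for which there exist a vertex x and a radius r > 0 with B(x, r/C) ⊆ [P]_a ⊆ B(x, C r) satisfies |∂P| ≥ c |P|^{(d-1)/d}. In particular, balls in X are not asymptotically isoperimetric: there are no constants C₁, C₂ with inf{|∂B(x,r)| : |B(x,r)| ≥ t} ≤ C₁ I(C₂ t) for all t. -/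
open SimpleGraph Set Filter

noncomputable section

/-- The ball of center `x` and radius `r` for the graph distance. -/
def gBall {V : Type*} (G : SimpleGraph V) (x : V) (r : ℕ) : Set V := {y | G.dist x y ≤ r}

/-- The ball of center `x` and real radius `ρ` for the graph distance. -/
def gBallR {V : Type*} (G : SimpleGraph V) (x : V) (ρ : ℝ) : Set V :=
  {y | (G.dist x y : ℝ) ≤ ρ}

/-- The `a`-neighborhood `[A]_a` of a set of vertices. -/
def gNbhd {V : Type*} (G : SimpleGraph V) (A : Set V) (a : ℝ) : Set V :=
  {y | ∃ p ∈ A, (G.dist y p : ℝ) ≤ a}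

/-- The boundary `∂A = {y : d(y,A) ≤ 1 and d(y,Aᶜ) ≤ 1}` of a set of vertices. -/
def gBdry {V : Type*} (G : SimpleGraph V) (A : Set V) : Set V :=
  {y | (∃ a ∈ A, G.dist y a ≤ 1) ∧ ∃ a ∈ Aᶜ, G.dist y a ≤ 1}

/-- `G` has bounded degree. -/
def BddDegree {V : Type*} (G : SimpleGraph V) : Prop :=
  ∃ D : ℕ, ∀ v : V, (G.neighborSet v).ncard ≤ D

/-- `G` has polynomial growth of degree `d`. -/
def PolyGrowth {V : Type*} (G : SimpleGraph V) (d : ℕ) : Prop :=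
  ∃ C : ℝ, 1 ≤ C ∧ ∀ (x : V) (r : ℕ), 1 ≤ r →
    C⁻¹ * (r : ℝ) ^ d ≤ ((gBall G x r).ncard : ℝ) ∧
    ((gBall G x r).ncard : ℝ) ≤ C * (r : ℝ) ^ d

/-- The isoperimetric profile `I(t) = inf {|∂A| : A finite, |A| ≥ t}`. -/
def gProfile {V : Type*} (G : SimpleGraph V) (t : ℕ) : ℕ :=
  sInf {m : ℕ | ∃ A : Set V, A.Finite ∧ t ≤ A.ncard ∧ (gBdry G A).ncard = m}

/-- The profile restricted to balls: `inf {|∂B(x,r)| : |B(x,r)| ≥ t}`. -/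
def gBallProfile {V : Type*} (G : SimpleGraph V) (t : ℕ) : ℕ :=
  sInf {m : ℕ | ∃ (x : V) (r : ℕ), 0 < r ∧ t ≤ (gBall G x r).ncard ∧
    (gBdry G (gBall G x r)).ncard = m}

/-! ### The construction

The vertices are the points of the orthant `ℕ × ℕ^k` (layer `false`), together with a second copy
(layer `true`) of the horn `{(x,y) : y i ≤ √x}`; the two layers communicate only at the points
`(j², 0)`. -/

/-- Vertices of the graph. -/
structure Vtx (k : ℕ) where
  x : ℕ
  y : Fin k → ℕ
  b : Bool
  h : b = true → ∀ i, y i ≤ Nat.sqrt x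

theorem Vtx.ext' {k : ℕ} {u v : Vtx k} (hx : u.x = v.x) (hy : u.y = v.y) (hb : u.b = v.b) :
    u = v := by
  cases u; cases v; simp_all

def XRel {k : ℕ} (u v : Vtx k) : Prop :=
  (u.b = v.b ∧ (u.x ≤ v.x + 1 ∧ v.x ≤ u.x + 1) ∧ ∀ i, u.y i ≤ v.y i + 1 ∧ v.y i ≤ u.y i + 1) ∨
  (u.x = v.x ∧ u.y = v.y ∧ (∃ j, u.x = j * j) ∧ ∀ i, u.y i = 0)

theorem XRel.symm {k : ℕ} {u v : Vtx k} (h : XRel u v) : XRel v u := by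
  rcases h with ⟨h1, h2, h3⟩ | ⟨h1, h2, h3, h4⟩
  · exact Or.inl ⟨h1.symm, h2.symm, fun i => (h3 i).symm⟩
  · exact Or.inr ⟨h1.symm, h2.symm, h1 ▸ h3, h2 ▸ h4⟩

def XG (k : ℕ) : SimpleGraph (Vtx k) where
  Adj u v := u ≠ v ∧ XRel u v
  symm := ⟨fun _ _ h => ⟨h.1.symm, h.2.symm⟩⟩
  loopless := ⟨fun _ h => h.1 rfl⟩

/-- `v` can be reached from `u` in at most `n` steps. -/
def Rch {k : ℕ} (n : ℕ) (u v : Vtx k) : Prop := ∃ p : (XG k).Walk u v, p.length ≤ n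

theorem Rch.refl {k : ℕ} (n : ℕ) (u : Vtx k) : Rch n u u := ⟨.nil, by simp⟩

theorem Rch.trans {k m n : ℕ} {u v w : Vtx k} (h1 : Rch m u v) (h2 : Rch n v w) :
    Rch (m + n) u w := by
  obtain ⟨p, hp⟩ := h1
  obtain ⟨q, hq⟩ := h2
  exact ⟨p.append q, by rw [SimpleGraph.Walk.length_append]; omega⟩

theorem Rch.mono {k m n : ℕ} {u v : Vtx k} (h1 : Rch m u v) (h : m ≤ n) : Rch n u v := by
  obtain ⟨p, hp⟩ := h1
  exact ⟨p, by omega⟩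

theorem Rch.symm {k m : ℕ} {u v : Vtx k} (h1 : Rch m u v) : Rch m v u := by
  obtain ⟨p, hp⟩ := h1
  exact ⟨p.reverse, by simpa using hp⟩

theorem Rch.of_rel {k : ℕ} {u v : Vtx k} (h : XRel u v) : Rch 1 u v := by
  by_cases e : u = v
  · subst e; exact Rch.refl _ _
  · exact ⟨.cons (show (XG k).Adj u v from ⟨e, h⟩) .nil, by simp⟩

theorem coord_of_walk {k : ℕ} {u v : Vtx k} (p : (XG k).Walk u v) :
    (u.x ≤ v.x + p.length ∧ v.x ≤ u.x + p.length) ∧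
      ∀ i, u.y i ≤ v.y i + p.length ∧ v.y i ≤ u.y i + p.length := by
  induction p with
  | nil => simp
  | cons h p ih =>
    rw [SimpleGraph.Walk.length_cons]
    rcases h.2 with ⟨h1, h2, h3⟩ | ⟨h1, h2, h3, h4⟩
    · refine ⟨by omega, fun i => ?_⟩
      have := h3 i; have := ih.2 i; omega
    · refine ⟨by omega, fun i => ?_⟩
      have := congrFun h2 i; have := ih.2 i; omega

/-- One step from `a` towards `c`. -/
def stepTo (a c : ℕ) : ℕ := if a < c then a + 1 else if c < a then a - 1 else a

theorem rch_layer {k : ℕ} (n : ℕ) : ∀ (u v : Vtx k), u.b = v.b →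
    (u.x ≤ v.x + n ∧ v.x ≤ u.x + n) → (∀ i, u.y i ≤ v.y i + n ∧ v.y i ≤ u.y i + n) →
    (u.b = true → u.x ≤ v.x ∧ ∀ i, v.y i ≤ Nat.sqrt u.x) → Rch n u v := by
  induction n with
  | zero =>
    intro u v hb hx hy _
    have : u = v := by
      apply Vtx.ext' (by omega) _ hb
      funext i
      have := hy i; omega
    subst this; exact Rch.refl _ _
  | succ n ih =>
    intro u v hb hx hy hT
    have hstep : ∀ a c : ℕ, stepTo a c ≤ max a c := by
      intro a c; unfold stepTo; split_ifs <;> omega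
    have hsx : u.b = true → u.x ≤ stepTo u.x v.x := by
      intro h
      have := (hT h).1
      unfold stepTo; split_ifs <;> omega
    let w : Vtx k := ⟨stepTo u.x v.x, fun i => stepTo (u.y i) (v.y i), u.b, by
      intro h i
      have h1 := hstep (u.y i) (v.y i)
      have h2 := u.h h i
      have h3 := (hT h).2 i
      have h4 := Nat.sqrt_le_sqrt (hsx h)
      omega⟩
    have hs1 : ∀ a c : ℕ, a ≤ stepTo a c + 1 ∧ stepTo a c ≤ a + 1 := by
      intro a c; unfold stepTo; split_ifs <;> omega
    have hs2 : ∀ a c : ℕ, a ≤ c + (n + 1) ∧ c ≤ a + (n + 1) →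
        stepTo a c ≤ c + n ∧ c ≤ stepTo a c + n := by
      intro a c; unfold stepTo; split_ifs <;> omega
    have huw : Rch 1 u w := Rch.of_rel (Or.inl ⟨rfl, hs1 _ _, fun i => hs1 _ _⟩)
    have hwv : Rch n w v := by
      apply ih w v hb (hs2 _ _ hx) (fun i => hs2 _ _ (hy i))
      intro h
      refine ⟨?_, fun i => ((hT h).2 i).trans (Nat.sqrt_le_sqrt (hsx h))⟩
      have := (hT h).1
      have := hstep u.x v.x
      change stepTo u.x v.x ≤ v.x
      omega
    exact (huw.trans hwv).mono (by omega)

def basePt {k : ℕ} (x : ℕ) (y : Fin k → ℕ) : Vtx k := ⟨x, y, false, by simp⟩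

theorem rch_base {k n : ℕ} {x x' : ℕ} {y y' : Fin k → ℕ} (hx : x ≤ x' + n ∧ x' ≤ x + n)
    (hy : ∀ i, y i ≤ y' i + n ∧ y' i ≤ y i + n) : Rch n (basePt x y) (basePt x' y') :=
  rch_layer n _ _ rfl hx hy (by simp [basePt])

/-- From a point of the horn one reaches the base within `2(√x+1)` steps. -/
theorem rch_contact {k : ℕ} (u : Vtx k) (hu : u.b = true) :
    Rch (2 * (Nat.sqrt u.x + 1)) u
      (basePt ((Nat.sqrt u.x + 1) * (Nat.sqrt u.x + 1)) (fun _ => 0)) := by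
  set m := Nat.sqrt u.x with hm
  have h1 : m * m ≤ u.x := Nat.sqrt_le u.x
  have h2 : u.x < (m + 1) * (m + 1) := Nat.lt_succ_sqrt u.x
  let w : Vtx k := ⟨(m + 1) * (m + 1), fun _ => 0, true, by simp⟩
  have e : (m + 1) * (m + 1) = m * m + 2 * m + 1 := by ring
  have huw : Rch (2 * m + 1) u w := by
    apply rch_layer _ u w hu
    · change u.x ≤ (m + 1) * (m + 1) + _ ∧ (m + 1) * (m + 1) ≤ _
      omega
    · intro i
      have := u.h hu i
      change u.y i ≤ 0 + _ ∧ 0 ≤ _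
      omega
    · intro _
      exact ⟨h2.le, fun i => Nat.zero_le _⟩
  have hw : Rch 1 w (basePt ((m + 1) * (m + 1)) (fun _ => 0)) :=
    Rch.of_rel (Or.inr ⟨rfl, rfl, ⟨m + 1, rfl⟩, fun _ => rfl⟩)
  exact (huw.trans hw).mono (by omega)

theorem rch_to_base {k : ℕ} (u : Vtx k) : ∃ n x y, Rch n u (basePt x y) := by
  cases hu : u.b
  · refine ⟨0, u.x, u.y, ?_⟩
    have : u = basePt u.x u.y := Vtx.ext' rfl rfl hu
    rw [← this]; exact Rch.refl _ _
  · exact ⟨_, _, _, rch_contact u hu⟩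

theorem XG_connected (k : ℕ) : (XG k).Connected := by
  have hz : ∀ u : Vtx k, ∃ n, Rch n u (basePt 0 (fun _ => 0)) := by
    intro u
    obtain ⟨n, x, y, h⟩ := rch_to_base u
    refine ⟨_, h.trans (rch_base (n := x + ∑ i, y i) ?_ ?_)⟩
    · omega
    · intro i
      have := Finset.single_le_sum (f := y) (fun _ _ => Nat.zero_le _) (Finset.mem_univ i)
      omega
  refine (SimpleGraph.connected_iff _).2 ⟨?_, ⟨basePt 0 (fun _ => 0)⟩⟩
  intro u v
  obtain ⟨m, hm⟩ := hz u
  obtain ⟨n, hn⟩ := hz v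
  obtain ⟨p, -⟩ := hm.trans hn.symm
  exact ⟨p⟩

theorem dist_le_iff {k n : ℕ} {u v : Vtx k} : (XG k).dist u v ≤ n ↔ Rch n u v := by
  constructor
  · intro h
    obtain ⟨p, hp⟩ := (XG_connected k).exists_walk_length_eq_dist u v
    exact ⟨p, by omega⟩
  · rintro ⟨p, hp⟩
    exact (SimpleGraph.dist_le p).trans hp

theorem coord_of_rch {k n : ℕ} {u v : Vtx k} (h : Rch n u v) :
    (u.x ≤ v.x + n ∧ v.x ≤ u.x + n) ∧ ∀ i, u.y i ≤ v.y i + n ∧ v.y i ≤ u.y i + n := by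
  obtain ⟨p, hp⟩ := h
  have := coord_of_walk p
  refine ⟨by omega, fun i => ?_⟩
  have := this.2 i
  omega

/-- Coordinates. -/
def toProd {k : ℕ} (u : Vtx k) : ℕ × (Fin k → ℕ) × Bool := (u.x, u.y, u.b)

theorem toProd_inj (k : ℕ) : Function.Injective (toProd (k := k)) := by
  intro u v h
  simp only [toProd, Prod.mk.injEq] at h
  exact Vtx.ext' h.1 h.2.1 h.2.2

def boxF {k : ℕ} (u : Vtx k) (r : ℕ) : Finset (ℕ × (Fin k → ℕ) × Bool) :=
  (Finset.Icc (u.x - r) (u.x + r)) ×ˢ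
    ((Fintype.piFinset fun i => Finset.Icc (u.y i - r) (u.y i + r)) ×ˢ Finset.univ)

theorem boxF_card {k : ℕ} (u : Vtx k) (r : ℕ) : (boxF u r).card ≤ 2 * (2 * r + 1) ^ (k + 1) := by
  unfold boxF
  rw [Finset.card_product, Finset.card_product, Fintype.card_piFinset]
  have h1 : ∀ a : ℕ, (Finset.Icc (a - r) (a + r)).card ≤ 2 * r + 1 := by
    intro a; rw [Nat.card_Icc]; omega
  have h2 : ∏ i, (Finset.Icc (u.y i - r) (u.y i + r)).card ≤ (2 * r + 1) ^ k := by
    calc _ ≤ ∏ _i : Fin k, (2 * r + 1) := Finset.prod_le_prod' fun i _ => h1 _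
      _ = _ := by simp
  calc _ ≤ (2 * r + 1) * ((2 * r + 1) ^ k * 2) := by
        refine Nat.mul_le_mul (h1 _) (Nat.mul_le_mul h2 (by simp))
    _ = _ := by ring

theorem ball_maps {k : ℕ} (u : Vtx k) (r : ℕ) :
    ∀ v ∈ gBall (XG k) u r, toProd v ∈ (boxF u r : Set (ℕ × (Fin k → ℕ) × Bool)) := by
  intro v hv
  have := coord_of_rch (dist_le_iff.1 hv)
  simp only [boxF, toProd, Finset.mem_coe, Finset.mem_product, Finset.mem_Icc,
    Fintype.mem_piFinset, Finset.mem_univ, and_true]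
  refine ⟨by omega, fun i => ?_⟩
  have := this.2 i
  omega

theorem ball_finite {k : ℕ} (u : Vtx k) (r : ℕ) : (gBall (XG k) u r).Finite :=
  Set.Finite.of_injOn (ball_maps u r) (toProd_inj k).injOn (Finset.finite_toSet _)

theorem ball_upper {k : ℕ} (u : Vtx k) (r : ℕ) :
    (gBall (XG k) u r).ncard ≤ 2 * (2 * r + 1) ^ (k + 1) := by
  have := Set.ncard_le_ncard_of_injOn toProd (ball_maps u r) (toProd_inj k).injOn
    (Finset.finite_toSet _)
  rw [Set.ncard_coe_finset] at this
  exact this.trans (boxF_card u r)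

/-- A cube inside a set of vertices bounds its cardinality from below. -/
theorem cube_lower {k : ℕ} (S : Set (Vtx k)) (hS : S.Finite) (X s t : ℕ) (Y : Fin k → ℕ)
    (b : Bool)
    (h : ∀ x y, X ≤ x → x ≤ X + s → (∀ i, Y i ≤ y i ∧ y i ≤ Y i + t) →
      ∃ v ∈ S, v.x = x ∧ v.y = y ∧ v.b = b) : (s + 1) * (t + 1) ^ k ≤ S.ncard := by
  classical
  let F : Finset (ℕ × (Fin k → ℕ) × Bool) := (Finset.Icc X (X + s)) ×ˢ
    ((Fintype.piFinset fun i => Finset.Icc (Y i) (Y i + t)) ×ˢ {b})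
  have hF : F.card = (s + 1) * (t + 1) ^ k := by
    simp only [F, Finset.card_product, Fintype.card_piFinset, Nat.card_Icc, Finset.card_singleton]
    have e : ∀ a c : ℕ, a + c + 1 - a = c + 1 := by intro a c; omega
    simp [e]
  have hsub : (F : Set (ℕ × (Fin k → ℕ) × Bool)) ⊆ toProd '' S := by
    rintro ⟨x, y, b'⟩ hm
    simp only [F, Finset.mem_coe, Finset.mem_product, Finset.mem_Icc,
      Fintype.mem_piFinset, Finset.mem_singleton] at hm
    obtain ⟨⟨h1, h2⟩, h3, h4⟩ := hm
    obtain ⟨v, hv, e1, e2, e3⟩ := h x y h1 h2 h3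
    exact ⟨v, hv, by simp [toProd, e1, e2, e3, h4]⟩
  calc _ = (F : Set (ℕ × (Fin k → ℕ) × Bool)).ncard := by rw [Set.ncard_coe_finset, hF]
    _ ≤ (toProd '' S).ncard := Set.ncard_le_ncard hsub (hS.image _)
    _ ≤ _ := Set.ncard_image_le hS

theorem base_lower {k : ℕ} (x : ℕ) (y : Fin k → ℕ) (r : ℕ) (S : Set (Vtx k)) (hS : S.Finite)
    (h : ∀ v, Rch r (basePt x y) v → v ∈ S) : (r + 1) ^ (k + 1) ≤ S.ncard := by
  have := cube_lower S hS x r r y false (by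
    intro x' y' h1 h2 h3
    refine ⟨basePt x' y', h _ (rch_base (by omega) fun i => ?_), rfl, rfl, rfl⟩
    have := h3 i
    omega)
  rwa [← pow_succ'] at this

theorem ball_lower {k : ℕ} (u : Vtx k) (r : ℕ) :
    (r / 4 + 1) ^ (k + 1) ≤ (gBall (XG k) u r).ncard := by
  cases hu : u.b
  · have e : u = basePt u.x u.y := Vtx.ext' rfl rfl hu
    have := base_lower u.x u.y r (gBall (XG k) u r) (ball_finite u r) (by
      intro v hv
      rw [← e] at hv
      exact dist_le_iff.2 hv)
    exact le_trans (Nat.pow_le_pow_left (by omega) _) this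
  · set m := Nat.sqrt u.x with hm
    by_cases hr : 4 * (m + 1) ≤ r
    · have hc := rch_contact u hu
      rw [← hm] at hc
      have := base_lower _ _ (r - 2 * (m + 1)) (gBall (XG k) u r) (ball_finite u r) (by
        intro v hv
        exact dist_le_iff.2 ((hc.trans hv).mono (by omega)))
      exact le_trans (Nat.pow_le_pow_left (by omega) _) this
    · have := cube_lower (gBall (XG k) u r) (ball_finite u r) u.x (r / 4) (r / 4)
        (fun i => u.y i - r / 4) true (by
          intro x' y' h1 h2 h3
          have hy : ∀ i, y' i ≤ m := by
            intro i
            have := h3 i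
            have := u.h hu i
            omega
          refine ⟨⟨x', y', true, fun _ i => (hy i).trans (Nat.sqrt_le_sqrt h1)⟩,
            dist_le_iff.2 ?_, rfl, rfl, rfl⟩
          apply rch_layer _ _ _ hu
          · change u.x ≤ x' + r ∧ x' ≤ u.x + r
            omega
          · intro i
            have := h3 i
            change u.y i ≤ y' i + r ∧ y' i ≤ u.y i + r
            omega
          · intro _
            exact ⟨h1, hy⟩)
      rwa [← pow_succ'] at this

theorem XG_growth (k : ℕ) : PolyGrowth (XG k) (k + 1) := by
  refine ⟨6 ^ (k + 1), one_le_pow₀ (by norm_num), fun u r hr => ⟨?_, ?_⟩⟩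
  · have h := ball_lower u r
    have h1 : (r : ℝ) / 6 ≤ ((r / 4 + 1 : ℕ) : ℝ) := by
      have : r ≤ 6 * (r / 4 + 1) := by omega
      have : (r : ℝ) ≤ 6 * ((r / 4 + 1 : ℕ) : ℝ) := by exact_mod_cast this
      linarith
    calc ((6 : ℝ) ^ (k + 1))⁻¹ * (r : ℝ) ^ (k + 1) = ((r : ℝ) / 6) ^ (k + 1) := by
          rw [div_pow]; ring
      _ ≤ ((r / 4 + 1 : ℕ) : ℝ) ^ (k + 1) := by gcongr
      _ ≤ _ := by exact_mod_cast h
  · have h := ball_upper u r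
    have h2 : 2 * (2 * r + 1) ^ (k + 1) ≤ 6 ^ (k + 1) * r ^ (k + 1) := by
      calc 2 * (2 * r + 1) ^ (k + 1) ≤ 2 ^ (k + 1) * (3 * r) ^ (k + 1) := by
            apply Nat.mul_le_mul
            · rw [pow_succ]; have := Nat.one_le_two_pow (n := k); omega
            · exact Nat.pow_le_pow_left (by omega) _
        _ = _ := by rw [← mul_pow, ← mul_pow]; ring
    exact_mod_cast h.trans h2

theorem XG_bdd (k : ℕ) : BddDegree (XG k) := by
  refine ⟨_, fun v => le_trans (Set.ncard_le_ncard ?_ (ball_finite v 1)) (ball_upper v 1)⟩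
  intro w hw
  exact dist_le_iff.2 (Rch.of_rel hw.2)

theorem bdry_finite {k : ℕ} {P : Set (Vtx k)} (hP : P.Finite) : (gBdry (XG k) P).Finite := by
  refine (hP.biUnion fun p _ => ball_finite p 1).subset ?_
  rintro v ⟨⟨a, ha, h⟩, -⟩
  exact Set.mem_biUnion ha (dist_le_iff.2 (dist_le_iff.1 h).symm)

/-- The basic isoperimetric inequality. -/
theorem isop {k : ℕ} (P : Set (Vtx k)) (hP : P.Finite) (u : Vtx k) (R : ℕ)
    (hPR : P ⊆ gBall (XG k) u R) :
    P.ncard ≤ (gBdry (XG k) P).ncard * (2 * R + 1) := by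
  classical
  have key : ∀ p : Vtx k, ∃ q : Vtx k, p ∈ P → q ∈ gBdry (XG k) P ∧ q.y = p.y ∧ q.b = p.b := by
    intro p
    by_cases hp : p ∈ P
    swap
    · exact ⟨p, fun h => absurd h hp⟩
    let f : ℕ → Vtx k := fun j => ⟨p.x + j, p.y, p.b, fun h i =>
      (p.h h i).trans (Nat.sqrt_le_sqrt (Nat.le_add_right _ _))⟩
    have hf0 : f 0 = p := Vtx.ext' rfl rfl rfl
    have hex : ∃ j, f j ∈ P ∧ f (j + 1) ∉ P := by
      by_contra hcon
      push Not at hcon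
      have hall : ∀ j, f j ∈ P := by
        intro j
        induction j with
        | zero => rw [hf0]; exact hp
        | succ j ih => exact hcon j ih
      have := (coord_of_rch (dist_le_iff.1 (hPR (hall (u.x + R + 1))))).1.2
      change p.x + (u.x + R + 1) ≤ u.x + R at this
      omega
    obtain ⟨j, h1, h2⟩ := hex
    refine ⟨f j, fun _ => ⟨⟨⟨f j, h1, by simp⟩, f (j + 1), h2, dist_le_iff.2 (Rch.of_rel ?_)⟩,
      rfl, rfl⟩⟩
    refine Or.inl ⟨rfl, ?_, fun i => ?_⟩
    · change p.x + j ≤ p.x + (j + 1) + 1 ∧ p.x + (j + 1) ≤ p.x + j + 1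
      omega
    · change p.y i ≤ p.y i + 1 ∧ p.y i ≤ p.y i + 1
      omega
  choose q hq using key
  have := Set.ncard_le_ncard_of_injOn (s := P)
    (t := (gBdry (XG k) P) ×ˢ (Finset.Icc (u.x - R) (u.x + R) : Set ℕ))
    (fun p => (q p, p.x)) (by
      intro p hp
      refine ⟨(hq p hp).1, ?_⟩
      have := (coord_of_rch (dist_le_iff.1 (hPR hp))).1
      simp only [Finset.coe_Icc, Set.mem_Icc]
      omega) (by
      intro p hp p' hp' h
      simp only [Prod.mk.injEq] at h
      have h1 := hq p hp
      have h2 := hq p' hp'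
      exact Vtx.ext' h.2 (by rw [← h1.2.1, ← h2.2.1, h.1]) (by rw [← h1.2.2, ← h2.2.2, h.1]))
    ((bdry_finite hP).prod (Finset.finite_toSet _))
  rw [Set.ncard_prod, Set.ncard_coe_finset] at this
  refine this.trans (Nat.mul_le_mul_left _ ?_)
  rw [Nat.card_Icc]; omega

theorem nbhd_card {k : ℕ} (P : Set (Vtx k)) (hP : P.Finite) (a : ℝ) :
    (gNbhd (XG k) P a).Finite ∧
    (gNbhd (XG k) P a).ncard ≤ P.ncard * (2 * (2 * ⌊a⌋₊ + 1) ^ (k + 1)) := by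
  classical
  have hsub : gNbhd (XG k) P a ⊆ ⋃ p ∈ P, gBall (XG k) p ⌊a⌋₊ := by
    rintro v ⟨p, hp, h⟩
    exact Set.mem_biUnion hp (dist_le_iff.2 (dist_le_iff.1 (Nat.le_floor h)).symm)
  have hfin := hP.biUnion fun p _ => ball_finite p ⌊a⌋₊
  refine ⟨hfin.subset hsub, (Set.ncard_le_ncard hsub hfin).trans ?_⟩
  have e : (⋃ p ∈ P, gBall (XG k) p ⌊a⌋₊) =
      ((hP.toFinset.biUnion fun p => (ball_finite p ⌊a⌋₊).toFinset : Finset (Vtx k)) :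
        Set (Vtx k)) := by
    ext v; simp
  rw [e, Set.ncard_coe_finset, Set.ncard_eq_toFinset_card P hP]
  apply Finset.card_biUnion_le_card_mul
  intro p _
  rw [← Set.ncard_eq_toFinset_card _ (ball_finite p ⌊a⌋₊)]
  exact ball_upper p _

theorem XG_part2 (k : ℕ) (C : ℝ) (hC : 1 ≤ C) (a : ℝ) (ha : 0 < a) : ∃ c : ℝ, 0 < c ∧
    ∀ P : Set (Vtx k), P.Finite →
      (∃ (x : Vtx k) (r : ℝ), 0 < r ∧ gBallR (XG k) x (r / C) ⊆ gNbhd (XG k) P a ∧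
        gNbhd (XG k) P a ⊆ gBallR (XG k) x (C * r)) →
      c * (P.ncard : ℝ) ^ ((((k + 1 : ℕ) : ℝ) - 1) / ((k + 1 : ℕ) : ℝ)) ≤
        ((gBdry (XG k) P).ncard : ℝ) := by
  set K : ℝ := ((2 * (2 * ⌊a⌋₊ + 1) ^ (k + 1) : ℕ) : ℝ) with hK
  have hK1 : 1 ≤ K := by
    rw [hK]
    have : 1 ≤ 2 * (2 * ⌊a⌋₊ + 1) ^ (k + 1) := by
      have := Nat.pos_of_ne_zero (pow_ne_zero (k + 1) (show 2 * ⌊a⌋₊ + 1 ≠ 0 by omega))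
      omega
    exact_mod_cast this
  set M : ℝ := 2 * C * (4 * C * K) + 1 with hM
  have hMpos : 0 < M := by positivity
  refine ⟨M⁻¹, by positivity, ?_⟩
  rintro P hP ⟨x, r, hr, h1, h2⟩
  have hCpos : 0 < C := by linarith
  set R := ⌊C * r⌋₊ with hR
  have hPR : P ⊆ gBall (XG k) x R := by
    intro p hp
    have : p ∈ gBallR (XG k) x (C * r) := h2 ⟨p, hp, by simpa using ha.le⟩
    exact Nat.le_floor this
  have hiso := isop P hP x R hPR
  set s := ⌊r / C⌋₊ with hs
  have hball : gBall (XG k) x s ⊆ gNbhd (XG k) P a := by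
    intro v hv
    apply h1
    have hv' : (XG k).dist x v ≤ s := hv
    exact (Nat.le_floor_iff (by positivity)).1 hv'
  obtain ⟨hfin, hcard⟩ := nbhd_card P hP a
  have hlow : (s / 4 + 1) ^ (k + 1) ≤ P.ncard * (2 * (2 * ⌊a⌋₊ + 1) ^ (k + 1)) :=
    (ball_lower x s).trans ((Set.ncard_le_ncard hball hfin).trans hcard)
  have hlowR : ((s / 4 + 1 : ℕ) : ℝ) ^ (k + 1) ≤ (P.ncard : ℝ) * K := by
    rw [hK]; exact_mod_cast hlow
  have hrs : r ≤ 4 * C * ((s / 4 + 1 : ℕ) : ℝ) := by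
    have h3 : r / C < s + 1 := Nat.lt_floor_add_one _
    have h4 : s + 1 ≤ 4 * (s / 4 + 1) := by omega
    have h5 : (s : ℝ) + 1 ≤ 4 * ((s / 4 + 1 : ℕ) : ℝ) := by exact_mod_cast h4
    have h6 : r < (s + 1) * C := (div_lt_iff₀ hCpos).1 h3
    nlinarith
  set N : ℝ := (P.ncard : ℝ) with hN
  have hN1 : 1 ≤ N := by
    have : 0 < P.ncard := by
      by_contra hcon
      have h0 : P.ncard = 0 := by omega
      rw [h0, zero_mul] at hlow
      have := Nat.pos_of_ne_zero (pow_ne_zero (k + 1) (show s / 4 + 1 ≠ 0 by omega))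
      omega
    rw [hN]; exact_mod_cast this
  have hdpos : (0 : ℝ) < ((k + 1 : ℕ) : ℝ) := by positivity
  set e : ℝ := (((k + 1 : ℕ) : ℝ))⁻¹ with he
  have he1 : e ≤ 1 := by
    rw [he]; apply inv_le_one_of_one_le₀; push_cast; linarith [(Nat.cast_nonneg k : (0 : ℝ) ≤ k)]
  have he0 : 0 ≤ e := by positivity
  have hroot : ((s / 4 + 1 : ℕ) : ℝ) ≤ N ^ e * K := by
    calc ((s / 4 + 1 : ℕ) : ℝ) = (((s / 4 + 1 : ℕ) : ℝ) ^ (k + 1)) ^ e :=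
          (Real.pow_rpow_inv_natCast (by positivity) (by omega)).symm
      _ ≤ (N * K) ^ e := Real.rpow_le_rpow (by positivity) hlowR he0
      _ = N ^ e * K ^ e := Real.mul_rpow (by linarith) (by linarith)
      _ ≤ N ^ e * K := by
          apply mul_le_mul_of_nonneg_left _ (by positivity)
          calc K ^ e ≤ K ^ (1 : ℝ) := Real.rpow_le_rpow_of_exponent_le hK1 he1
            _ = K := Real.rpow_one _
  have hNe : 1 ≤ N ^ e := Real.one_le_rpow hN1 he0
  have hR' : (2 * (R : ℝ) + 1) ≤ M * N ^ e := by
    have hRr : (R : ℝ) ≤ C * r := Nat.floor_le (by positivity)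
    have : r ≤ 4 * C * (N ^ e * K) := hrs.trans (by gcongr)
    calc 2 * (R : ℝ) + 1 ≤ 2 * (C * (4 * C * (N ^ e * K))) + N ^ e := by
          have : C * r ≤ C * (4 * C * (N ^ e * K)) := by gcongr
          linarith
      _ = M * N ^ e := by rw [hM]; ring
  have hisoR : N ≤ ((gBdry (XG k) P).ncard : ℝ) * (2 * (R : ℝ) + 1) := by
    rw [hN]; exact_mod_cast hiso
  have hexp : (((k + 1 : ℕ) : ℝ) - 1) / ((k + 1 : ℕ) : ℝ) = 1 - e := by
    rw [he]; field_simp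
  rw [hexp, Real.rpow_sub (by linarith), Real.rpow_one, inv_mul_le_iff₀ hMpos,
    div_le_iff₀ (by positivity)]
  calc N ≤ ((gBdry (XG k) P).ncard : ℝ) * (M * N ^ e) :=
        hisoR.trans (mul_le_mul_of_nonneg_left hR' (by positivity))
    _ = _ := by ring

/-- Truncated horns. -/
def hornA (k n : ℕ) : Set (Vtx k) := {v | v.b = true ∧ v.x < 4 * (n * n)}

theorem hornA_finite (k n : ℕ) : (hornA k n).Finite := by
  refine Set.Finite.of_injOn (f := toProd)
    (t := ((Finset.range (4 * (n * n)) ×ˢ ((Fintype.piFinset fun _ : Fin k =>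
      Finset.range (2 * n + 1)) ×ˢ Finset.univ) : Finset (ℕ × (Fin k → ℕ) × Bool)) :
        Set (ℕ × (Fin k → ℕ) × Bool))) ?_ (toProd_inj k).injOn (Finset.finite_toSet _)
  rintro v ⟨hb, hx⟩
  simp only [toProd, Finset.mem_coe, Finset.mem_product, Finset.mem_range,
    Fintype.mem_piFinset, Finset.mem_univ, and_true]
  refine ⟨hx, fun i => ?_⟩
  have h1 := v.h hb i
  have h2 : Nat.sqrt v.x < 2 * n := Nat.sqrt_lt.2 (by nlinarith)
  omega

theorem hornA_lower (k n : ℕ) (hn : 1 ≤ n) : n ^ (k + 2) ≤ (hornA k n).ncard := by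
  have hnn : 1 ≤ n * n := Nat.mul_pos hn hn
  have := cube_lower (hornA k n) (hornA_finite k n) (n * n) (n * n) n (fun _ => 0) true (by
    intro x y h1 h2 h3
    refine ⟨⟨x, y, true, fun _ i => ?_⟩, ⟨rfl, ?_⟩, rfl, rfl, rfl⟩
    · have := (h3 i).2
      have : n ≤ Nat.sqrt x := Nat.le_sqrt.2 h1
      omega
    · change x < 4 * (n * n)
      omega)
  refine le_trans ?_ this
  calc n ^ (k + 2) = (n * n) * n ^ k := by ring
    _ ≤ _ := Nat.mul_le_mul (by omega) (Nat.pow_le_pow_left (by omega) _)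

theorem hornA_bdry (k n : ℕ) (hn : 1 ≤ n) (hk : 1 ≤ k) :
    (gBdry (XG k) (hornA k n)).ncard ≤ (2 * 3 ^ k + 4) * n ^ k := by
  classical
  set N := 4 * (n * n) with hN
  have hNpos : 1 ≤ N := by have := Nat.mul_pos hn hn; omega
  let F₁ : Finset (ℕ × (Fin k → ℕ) × Bool) := {N - 1, N} ×ˢ
    ((Fintype.piFinset fun _ : Fin k => Finset.range (2 * n + 1)) ×ˢ {true})
  let F₂ : Finset (ℕ × (Fin k → ℕ) × Bool) := ((Finset.range (2 * n)).image fun j => j * j) ×ˢ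
    (({fun _ => 0} : Finset (Fin k → ℕ)) ×ˢ Finset.univ)
  have hsq : ∀ x, x ≤ N → Nat.sqrt x ≤ 2 * n := by
    intro x hx
    have : Nat.sqrt x < 2 * n + 1 := Nat.sqrt_lt.2 (by nlinarith)
    omega
  have mem1 : ∀ v : Vtx k, v.b = true → (v.x = N - 1 ∨ v.x = N) → toProd v ∈ F₁ := by
    intro v hb hx
    simp only [F₁, toProd, Finset.mem_product, Finset.mem_range,
      Fintype.mem_piFinset, Finset.mem_insert, Finset.mem_singleton]
    refine ⟨hx, fun i => ?_, hb⟩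
    have := v.h hb i
    have := hsq v.x (by omega)
    omega
  have mem2 : ∀ v : Vtx k, v.x < N → (∃ j, v.x = j * j) → (∀ i, v.y i = 0) →
      toProd v ∈ F₂ := by
    rintro v hx ⟨j, hj⟩ hy
    simp only [F₂, toProd, Finset.mem_product, Finset.mem_image, Finset.mem_range,
      Finset.mem_singleton, Finset.mem_univ, and_true]
    refine ⟨⟨j, ?_, hj.symm⟩, funext hy⟩
    by_contra hcon
    have : 2 * n ≤ j := by omega
    have := Nat.mul_le_mul this this
    have e : 2 * n * (2 * n) = N := by rw [hN]; ring
    omega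
  have edge : ∀ v w : Vtx k, v ∈ hornA k n → w ∉ hornA k n → XRel v w →
      toProd v ∈ F₁ ∪ F₂ ∧ toProd w ∈ F₁ ∪ F₂ := by
    rintro v w ⟨hb, hx⟩ hw h
    change v.x < N at hx
    have hw' : w.b = true → N ≤ w.x := by
      intro h; by_contra hcon; exact hw ⟨h, by omega⟩
    rcases h with ⟨h1, h2, h3⟩ | ⟨h1, h2, h3, h4⟩
    · have hwb : w.b = true := h1 ▸ hb
      have := hw' hwb
      exact ⟨Finset.mem_union_left _ (mem1 v hb (by omega)),
        Finset.mem_union_left _ (mem1 w hwb (by omega))⟩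
    · exact ⟨Finset.mem_union_right _ (mem2 v hx h3 h4),
        Finset.mem_union_right _ (mem2 w (h1 ▸ hx) (h1 ▸ h3) (h2 ▸ h4))⟩
  have rel : ∀ v w : Vtx k, (XG k).dist v w ≤ 1 → v ≠ w → XRel v w := by
    intro v w h hne
    have hpos := (XG_connected k).pos_dist_of_ne hne
    have h1 : (XG k).dist v w = 1 := by omega
    exact (SimpleGraph.dist_eq_one_iff_adj.1 h1).2
  have hmaps : ∀ v ∈ gBdry (XG k) (hornA k n),
      toProd v ∈ ((F₁ ∪ F₂ : Finset _) : Set (ℕ × (Fin k → ℕ) × Bool)) := by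
    rintro v ⟨⟨a, ha, h1⟩, c, hc, h2⟩
    by_cases hv : v ∈ hornA k n
    · exact (edge v c hv hc (rel v c h2 (by rintro rfl; exact hc hv))).1
    · exact (edge a v ha hv (rel v a h1 (by rintro rfl; exact hv ha)).symm).2
  have := Set.ncard_le_ncard_of_injOn toProd hmaps (toProd_inj k).injOn (Finset.finite_toSet _)
  rw [Set.ncard_coe_finset] at this
  refine this.trans ((Finset.card_union_le _ _).trans ?_)
  have c1 : F₁.card ≤ 2 * (3 ^ k * n ^ k) := by
    simp only [F₁, Finset.card_product, Fintype.card_piFinset, Finset.card_singleton,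
      Finset.card_range, Finset.prod_const, Finset.card_univ, Fintype.card_fin, mul_one]
    refine Nat.mul_le_mul Finset.card_le_two ?_
    rw [← mul_pow]
    exact Nat.pow_le_pow_left (by omega) _
  have c2 : F₂.card ≤ 4 * n ^ k := by
    simp only [F₂, Finset.card_product, Finset.card_singleton, Finset.card_univ,
      Fintype.card_bool, one_mul]
    have h1 : ((Finset.range (2 * n)).image fun j => j * j).card ≤ 2 * n :=
      Finset.card_image_le.trans (by simp)
    have h2 : n ≤ n ^ k := Nat.le_self_pow (by omega) n
    calc _ ≤ 2 * n * 2 := Nat.mul_le_mul_right _ h1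
      _ ≤ _ := by omega
  calc _ ≤ 2 * (3 ^ k * n ^ k) + 4 * n ^ k := Nat.add_le_add c1 c2
    _ = _ := by ring

theorem hornA_ratio (k : ℕ) (hk : 1 ≤ k) :
    Tendsto (fun n => ((gBdry (XG k) (hornA k n)).ncard : ℝ) /
      ((hornA k n).ncard : ℝ) ^ ((((k + 1 : ℕ) : ℝ) - 1) / ((k + 1 : ℕ) : ℝ))) atTop (nhds 0) := by
  set e : ℝ := (((k + 1 : ℕ) : ℝ) - 1) / ((k + 1 : ℕ) : ℝ) with he
  have hkpos : (0 : ℝ) < k := by exact_mod_cast hk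
  have he' : e = (k : ℝ) / (k + 1) := by rw [he]; push_cast; ring
  have hepos : 0 < e := by rw [he']; positivity
  have hlim : Tendsto (fun n : ℕ => ((2 * 3 ^ k + 4 : ℕ) : ℝ) * ((n : ℝ) ^ (-e))) atTop
      (nhds 0) := by
    have := ((tendsto_rpow_neg_atTop hepos).comp tendsto_natCast_atTop_atTop).const_mul
      ((2 * 3 ^ k + 4 : ℕ) : ℝ)
    simpa using this
  refine tendsto_of_tendsto_of_tendsto_of_le_of_le' tendsto_const_nhds hlim
    (Eventually.of_forall fun n => by positivity) ?_
  filter_upwards [eventually_ge_atTop 1] with n hn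
  have hn0 : (0 : ℝ) < n := by exact_mod_cast hn
  have h1 : ((gBdry (XG k) (hornA k n)).ncard : ℝ) ≤ ((2 * 3 ^ k + 4 : ℕ) : ℝ) * (n : ℝ) ^ k := by
    exact_mod_cast hornA_bdry k n hn hk
  have h2 : (n : ℝ) ^ (k + 2) ≤ ((hornA k n).ncard : ℝ) := by
    exact_mod_cast hornA_lower k n hn
  have h3 : ((n : ℝ) ^ (k + 2)) ^ e ≤ ((hornA k n).ncard : ℝ) ^ e :=
    Real.rpow_le_rpow (by positivity) h2 hepos.le
  have h4 : ((n : ℝ) ^ (k + 2)) ^ e = (n : ℝ) ^ k * (n : ℝ) ^ e := by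
    rw [← Real.rpow_natCast, ← Real.rpow_natCast, ← Real.rpow_mul hn0.le, ← Real.rpow_add hn0]
    congr 1
    rw [he']; push_cast; field_simp; ring
  rw [h4] at h3
  calc _ ≤ (((2 * 3 ^ k + 4 : ℕ) : ℝ) * (n : ℝ) ^ k) / ((n : ℝ) ^ k * (n : ℝ) ^ e) := by
        gcongr
    _ = _ := by rw [Real.rpow_neg hn0.le]; field_simp

theorem hornA_tendsto (k : ℕ) : Tendsto (fun n => (hornA k n).ncard) atTop atTop := by
  refine tendsto_atTop_mono' atTop ?_ tendsto_id
  filter_upwards [eventually_ge_atTop 1] with n hn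
  exact (Nat.le_self_pow (by omega) n).trans (hornA_lower k n hn)

theorem ball_profile_lower (k : ℕ) : ∃ c : ℝ, 0 < c ∧ ∀ t : ℕ,
    c * (t : ℝ) ^ ((((k + 1 : ℕ) : ℝ) - 1) / ((k + 1 : ℕ) : ℝ)) ≤ (gBallProfile (XG k) t : ℝ) := by
  obtain ⟨c, hc, h⟩ := XG_part2 k 2 (by norm_num) 1 one_pos
  refine ⟨c, hc, fun t => ?_⟩
  have hne : {m : ℕ | ∃ (x : Vtx k) (r : ℕ), 0 < r ∧ t ≤ (gBall (XG k) x r).ncard ∧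
      (gBdry (XG k) (gBall (XG k) x r)).ncard = m}.Nonempty := by
    refine ⟨_, basePt 0 (fun _ => 0), 4 * (t + 1), by omega, ?_, rfl⟩
    refine le_trans ?_ (ball_lower _ _)
    refine le_trans ?_ (Nat.le_self_pow (by omega) _)
    omega
  obtain ⟨x, r, hr, ht, hm⟩ := Nat.sInf_mem hne
  have hm' : (gBdry (XG k) (gBall (XG k) x r)).ncard = gBallProfile (XG k) t := hm
  rw [← hm']
  have hr1 : (1 : ℝ) ≤ r := by exact_mod_cast hr
  have := h (gBall (XG k) x r) (ball_finite x r) ⟨x, r, by linarith, by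
      intro v hv
      have hv' : ((XG k).dist x v : ℝ) ≤ r / 2 := hv
      refine ⟨v, ?_, by simp⟩
      have h3 : ((XG k).dist x v : ℝ) ≤ r := by linarith
      exact_mod_cast h3, by
      rintro v ⟨p, hp, hd⟩
      have hp' : ((XG k).dist x p : ℝ) ≤ r := by
        have : (XG k).dist x p ≤ r := hp
        exact_mod_cast this
      have htri := (XG_connected k).dist_triangle (u := x) (v := p) (w := v)
      rw [(XG k).dist_comm (u := p)] at htri
      have htri' : ((XG k).dist x v : ℝ) ≤ (XG k).dist x p + (XG k).dist v p := by
        exact_mod_cast htri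
      change ((XG k).dist x v : ℝ) ≤ 2 * r
      linarith⟩
  refine le_trans ?_ this
  have he : 0 ≤ (((k + 1 : ℕ) : ℝ) - 1) / ((k + 1 : ℕ) : ℝ) := by
    push_cast
    have : (0 : ℝ) ≤ k := Nat.cast_nonneg k
    apply div_nonneg <;> linarith
  have htR : (t : ℝ) ≤ (gBall (XG k) x r).ncard := by exact_mod_cast ht
  gcongr

theorem XG_not_balls (k : ℕ) (hk : 1 ≤ k) : ¬ ∃ C₁ C₂ : ℕ, 0 < C₁ ∧ 0 < C₂ ∧
    ∀ t : ℕ, gBallProfile (XG k) t ≤ C₁ * gProfile (XG k) (C₂ * t) := by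
  rintro ⟨C₁, C₂, h1, h2, h⟩
  obtain ⟨c, hc, hb⟩ := ball_profile_lower k
  have hlim := hornA_ratio k hk
  set e : ℝ := (((k + 1 : ℕ) : ℝ) - 1) / ((k + 1 : ℕ) : ℝ) with hedef
  have he : 0 ≤ e := by
    rw [hedef]; push_cast
    have : (0 : ℝ) ≤ k := Nat.cast_nonneg k
    apply div_nonneg <;> linarith
  have hC1 : (0 : ℝ) < C₁ := by exact_mod_cast h1
  have hC2 : (0 : ℝ) < C₂ := by exact_mod_cast h2
  set q : ℝ := (2 * (C₂ : ℝ)) ^ e with hq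
  have hqpos : 0 < q := by positivity
  have hev := hlim.eventually (gt_mem_nhds (show 0 < c / (C₁ * q) by positivity))
  obtain ⟨n, hn1, hn2⟩ := (hev.and ((hornA_tendsto k).eventually (eventually_ge_atTop C₂))).exists
  set A := (hornA k n).ncard with hA
  set t := A / C₂ with ht
  have hA0 : (0 : ℝ) < A := by
    have : 0 < A := by omega
    exact_mod_cast this
  have hprof : gProfile (XG k) (C₂ * t) ≤ (gBdry (XG k) (hornA k n)).ncard :=
    Nat.sInf_le ⟨hornA k n, hornA_finite k n, Nat.mul_div_le _ _, rfl⟩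
  have h3 : gBallProfile (XG k) t ≤ C₁ * (gBdry (XG k) (hornA k n)).ncard :=
    (h t).trans (Nat.mul_le_mul_left _ hprof)
  have h3R : (gBallProfile (XG k) t : ℝ) ≤ C₁ * ((gBdry (XG k) (hornA k n)).ncard : ℝ) := by
    exact_mod_cast h3
  have htA : A ≤ 2 * C₂ * t := by
    have h4 : A < C₂ * (t + 1) := by
      rw [mul_comm]; exact Nat.lt_mul_of_div_lt (Nat.lt_succ_self _) h2
    have h5 : 1 ≤ t := (Nat.one_le_div_iff h2).2 hn2
    nlinarith
  have htAR : (A : ℝ) ≤ 2 * C₂ * t := by exact_mod_cast htA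
  have h6 : (A : ℝ) ^ e ≤ q * (t : ℝ) ^ e := by
    rw [hq, ← Real.mul_rpow (by positivity) (by positivity)]
    exact Real.rpow_le_rpow hA0.le htAR he
  have hApow : 0 < (A : ℝ) ^ e := Real.rpow_pos_of_pos hA0 _
  rw [div_lt_div_iff₀ hApow (by positivity)] at hn1
  have h7 := (hb t).trans h3R
  have h8 : c * (A : ℝ) ^ e ≤ c * (q * (t : ℝ) ^ e) := by gcongr
  have h9 : q * (c * (t : ℝ) ^ e) ≤ q * (C₁ * ((gBdry (XG k) (hornA k n)).ncard : ℝ)) := by gcongr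
  nlinarith

theorem exists_stably_NIB_graph_with_unbounded_profile (d : ℕ) (hd : 2 ≤ d) :
    ∃ (V : Type) (G : SimpleGraph V), Countable V ∧ Infinite V ∧
      G.Connected ∧ BddDegree G ∧ PolyGrowth G d ∧
      -- (1) the profile of X is not strong, witnessed by a sequence of sets:
      (∃ A : ℕ → Set V, (∀ n, (A n).Finite) ∧
        Tendsto (fun n => (A n).ncard) atTop atTop ∧
        Tendsto (fun n => ((gBdry G (A n)).ncard : ℝ) /
          ((A n).ncard : ℝ) ^ (((d : ℝ) - 1) / (d : ℝ))) atTop (nhds 0)) ∧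
      -- (2) any family squeezed between balls of comparable radii has a strong
      -- isoperimetric lower bound:
      (∀ C : ℝ, 1 ≤ C → ∀ a : ℝ, 0 < a → ∃ c : ℝ, 0 < c ∧
        ∀ P : Set V, P.Finite →
          (∃ (x : V) (r : ℝ), 0 < r ∧ gBallR G x (r / C) ⊆ gNbhd G P a ∧
            gNbhd G P a ⊆ gBallR G x (C * r)) →
          c * (P.ncard : ℝ) ^ (((d : ℝ) - 1) / (d : ℝ)) ≤ ((gBdry G P).ncard : ℝ)) ∧
      -- in particular, balls are not asymptotically isoperimetric:
      ¬ ∃ C₁ C₂ : ℕ, 0 < C₁ ∧ 0 < C₂ ∧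
        ∀ t : ℕ, gBallProfile G t ≤ C₁ * gProfile G (C₂ * t) := by
  obtain ⟨k, rfl⟩ : ∃ k, d = k + 1 := ⟨d - 1, by omega⟩
  have hk : 1 ≤ k := by omega
  refine ⟨Vtx k, XG k, (toProd_inj k).countable, ?_, XG_connected k, XG_bdd k, XG_growth k,
    ⟨hornA k, hornA_finite k, hornA_tendsto k, hornA_ratio k hk⟩, XG_part2 k, XG_not_balls k hk⟩
  refine Infinite.of_injective (fun n : ℕ => (basePt n (fun _ => 0) : Vtx k)) ?_
  intro m n h
  exact congrArg Vtx.x h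
end
end

section
/- For every integer d ≥ 2 there exist two connected simple graphs X and X' of bounded degree, both with polynomial growth of degree d and both with bounded isoperimetric profile, and a quasi-isometry f : X → X', such that: in X there is a sequence of balls B_n with |B_n| → ∞ and sup_n |∂B_n| < ∞ (so balls in X are asymptotically isoperimetric), while in X' there is a constant c > 0 with |∂B(x,r)| ≥ c |B(x,r)|^{(d-1)/d} for every ball B(x,r) of X' (so balls in X' are not asymptotically isoperimetric). In particular, the property that balls are asymptotically isoperimetric is not invariant under quasi-isometry among graphs of polynomial growth. -/
open SimpleGraph Set Filter

noncomputable section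

/-- `f` is a quasi-isometry between the graphs `G` and `G'`. -/
def GraphQI {V V' : Type*} (G : SimpleGraph V) (G' : SimpleGraph V') (f : V → V') : Prop :=
  ∃ C₁ : ℝ, 0 < C₁ ∧ ∃ C₂ : ℝ, 1 ≤ C₂ ∧
    (∀ y : V', ∃ x : V, (G'.dist y (f x) : ℝ) ≤ C₁) ∧
    (∀ x y : V, C₂⁻¹ * (G.dist x y : ℝ) - C₂ ≤ (G'.dist (f x) (f y) : ℝ) ∧
      (G'.dist (f x) (f y) : ℝ) ≤ C₂ * (G.dist x y : ℝ) + C₂)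

/-- The cube `[8·2^k, 16·2^k]^d`. -/
def cube (d k : ℕ) : Set (Fin d → ℤ) := {z | ∀ i, 8 * 2 ^ k ≤ z i ∧ z i ≤ 16 * 2 ^ k}

/-- The common vertex set of both graphs: a chain of cubes glued at corners. -/
abbrev VV (d : ℕ) : Type := {z : Fin d → ℤ // ∃ k, z ∈ cube d k}

/-- The `ℓ¹` distance. -/
def ell {d : ℕ} (v w : Fin d → ℤ) : ℤ := ∑ i, |v i - w i|

lemma ell_comm {d : ℕ} (v w : Fin d → ℤ) : ell v w = ell w v := by
  unfold ell
  exact Finset.sum_congr rfl fun _ _ => abs_sub_comm _ _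

lemma ell_nonneg {d : ℕ} (v w : Fin d → ℤ) : 0 ≤ ell v w :=
  Finset.sum_nonneg fun _ _ => abs_nonneg _

lemma ell_coord {d : ℕ} (v w : Fin d → ℤ) (i : Fin d) : |v i - w i| ≤ ell v w :=
  Finset.single_le_sum (f := fun i => |v i - w i|) (fun _ _ => abs_nonneg _) (Finset.mem_univ i)

lemma ell_self {d : ℕ} (v : Fin d → ℤ) : ell v v = 0 := by simp [ell]

lemma ell_update {d : ℕ} (v : Fin d → ℤ) (i : Fin d) (t : ℤ) :
    ell v (Function.update v i t) = |v i - t| := by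
  unfold ell
  rw [Finset.sum_eq_single i]
  · simp
  · intro j _ hj
    simp [hj]
  · simp

lemma ell_update_left {d : ℕ} (v w : Fin d → ℤ) (i : Fin d) (t : ℤ) :
    ell (Function.update v i t) w = ell v w - |v i - w i| + |t - w i| := by
  unfold ell
  rw [← Finset.add_sum_erase _ _ (Finset.mem_univ i),
    ← Finset.add_sum_erase (a := i) _ (fun i => |v i - w i|) (Finset.mem_univ i)]
  have : ∑ x ∈ Finset.univ.erase i, |Function.update v i t x - w x| =
      ∑ x ∈ Finset.univ.erase i, |v x - w x| := by
    refine Finset.sum_congr rfl fun j hj => ?_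
    simp [(Finset.mem_erase.1 hj).1]
  rw [this]; simp; ring

lemma ell_le {d : ℕ} (v w : Fin d → ℤ) (t : ℤ) (h : ∀ i, |v i - w i| ≤ t) : ell v w ≤ d * t := by
  unfold ell
  calc _ ≤ ∑ _i : Fin d, t := Finset.sum_le_sum fun i _ => h i
    _ = _ := by simp

def GX (d : ℕ) : SimpleGraph (VV d) where
  Adj v w := (∃ k, v.1 ∈ cube d k ∧ w.1 ∈ cube d k) ∧ ell v.1 w.1 = 1
  symm := ⟨fun v w ⟨⟨k, h1, h2⟩, h3⟩ => ⟨⟨k, h2, h1⟩, by rw [ell_comm]; exact h3⟩⟩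
  loopless := ⟨fun v h => by have := h.2; rw [ell_self] at this; omega⟩

def GY (d : ℕ) (i j : Fin d) : SimpleGraph (VV d) where
  Adj v w := v ≠ w ∧ (∃ k, v.1 ∈ cube d k ∧ w.1 ∈ cube d k) ∧
    |(v.1 i - v.1 j) - (w.1 i - w.1 j)| ≤ 1 ∧ ∀ l, |v.1 l - w.1 l| ≤ 4
  symm := ⟨fun v w ⟨h0, ⟨k, h1, h2⟩, h3, h4⟩ => ⟨h0.symm, ⟨k, h2, h1⟩, by rw [abs_sub_comm]; exact h3,
    fun l => by rw [abs_sub_comm]; exact h4 l⟩⟩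
  loopless := ⟨fun v h => h.1 rfl⟩

lemma GX_le_GY (d : ℕ) (i j : Fin d) (hij : i ≠ j) : GX d ≤ GY d i j := by
  intro v w h
  refine ⟨h.ne, h.1, ?_, fun l => (ell_coord _ _ l).trans (by rw [h.2]; norm_num)⟩
  have h2 := h.2
  have : |v.1 i - w.1 i| + |v.1 j - w.1 j| ≤ 1 := by
    rw [← h2, ell, ← Finset.sum_pair (f := fun l => |v.1 l - w.1 l|) hij]
    exact Finset.sum_le_sum_of_subset_of_nonneg (Finset.subset_univ _) fun _ _ _ => abs_nonneg _
  grind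

/-- Corner points. -/
def cpt (d k : ℕ) : VV d := ⟨fun _ => 8 * 2 ^ k, k, fun _ => ⟨le_rfl, by
  have : (0:ℤ) < 2 ^ k := by positivity
  linarith⟩⟩

lemma cpt_mem (d k : ℕ) : (cpt d k).1 ∈ cube d k := fun _ => ⟨le_rfl, by
  have : (0:ℤ) < 2 ^ k := by positivity
  simp only [cpt]; linarith⟩

lemma cpt_mem' (d k : ℕ) : (cpt d (k+1)).1 ∈ cube d k := fun _ => by
  have : (0:ℤ) < 2 ^ k := by positivity
  simp only [cpt, pow_succ]; constructor <;> linarith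

lemma walk_same {d k : ℕ} (n : ℕ) : ∀ (v w : VV d), v.1 ∈ cube d k → w.1 ∈ cube d k → ell v.1 w.1 = n →
    ∃ p : (GX d).Walk v w, p.length = n := by
  induction n with
  | zero =>
    intro v w hv hw h
    have : v = w := by
      apply Subtype.ext; funext i
      have := ell_coord v.1 w.1 i
      grind
    subst this
    exact ⟨Walk.nil, rfl⟩
  | succ n ih =>
    intro v w hv hw h
    obtain ⟨i, hi⟩ : ∃ i, v.1 i ≠ w.1 i := by
      by_contra! hc
      have : v.1 = w.1 := funext hc
      rw [this, ell_self] at h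
      push_cast at h; omega
    obtain ⟨t, ht1, ht2, ht3⟩ : ∃ t : ℤ, |v.1 i - t| = 1 ∧ |t - w.1 i| = |v.1 i - w.1 i| - 1 ∧
        (8 * 2 ^ k ≤ t ∧ t ≤ 16 * 2 ^ k) := by
      have h1 := hv i
      have h2 := hw i
      rcases lt_or_gt_of_ne hi with h3 | h3
      · refine ⟨v.1 i + 1, ?_, ?_, ?_⟩ <;> grind
      · refine ⟨v.1 i - 1, ?_, ?_, ?_⟩ <;> grind
    have hm : Function.update v.1 i t ∈ cube d k := by
      intro l
      by_cases hl : l = i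
      · subst hl; simpa using ht3
      · simpa [hl] using hv l
    obtain ⟨p, hp⟩ := ih ⟨Function.update v.1 i t, k, hm⟩ w hm hw (by
      rw [ell_update_left, ht2, h]; push_cast; ring)
    have hadj : (GX d).Adj v ⟨Function.update v.1 i t, k, hm⟩ :=
      ⟨⟨k, hv, hm⟩, by rw [ell_update]; exact ht1⟩
    exact ⟨Walk.cons hadj p, by simp [hp]⟩

lemma ell_add {d : ℕ} (u v w : Fin d → ℤ) (h1 : ∀ i, u i ≤ v i) (h2 : ∀ i, v i ≤ w i) :
    ell u v + ell v w = ell u w := by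
  unfold ell
  rw [← Finset.sum_add_distrib]
  refine Finset.sum_congr rfl fun i _ => ?_
  have := h1 i
  have := h2 i
  grind

lemma walk_le {d k : ℕ} (w : VV d) (hw : w.1 ∈ cube d k) (m : ℕ) : ∀ (j : ℕ) (v : VV d), j + m = k →
    v.1 ∈ cube d j → ∃ p : (GX d).Walk v w, (p.length : ℤ) = ell v.1 w.1 := by
  induction m with
  | zero =>
    intro j v hj hv
    have : j = k := by omega
    subst this
    obtain ⟨n, hn⟩ := Int.eq_ofNat_of_zero_le (ell_nonneg v.1 w.1)
    obtain ⟨p, hp⟩ := walk_same n v w hv hw hn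
    exact ⟨p, by rw [hp, hn]⟩
  | succ m ih =>
    intro j v hj hv
    obtain ⟨p, hp⟩ := ih (j+1) (cpt d (j+1)) (by omega) (cpt_mem _ _)
    obtain ⟨n, hn⟩ := Int.eq_ofNat_of_zero_le (ell_nonneg v.1 (cpt d (j+1)).1)
    obtain ⟨q, hq⟩ := walk_same n v _ hv (cpt_mem' _ _) hn
    refine ⟨q.append p, ?_⟩
    rw [Walk.length_append, Nat.cast_add, hp, hq, ← hn]
    apply ell_add
    · intro i
      have := (hv i).2
      simp only [cpt, pow_succ]; linarith
    · intro i
      have := (hw i).1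
      have h3 : (2:ℤ) ^ (j+1) ≤ 2 ^ k := pow_le_pow_right₀ (by norm_num) (by omega)
      simp only [cpt]; linarith

lemma walk_ell {d : ℕ} (v w : VV d) : ∃ p : (GX d).Walk v w, (p.length : ℤ) = ell v.1 w.1 := by
  obtain ⟨j, hj⟩ := v.2
  obtain ⟨k, hk⟩ := w.2
  rcases le_total j k with h | h
  · exact walk_le w hk (k - j) j v (by omega) hj
  · obtain ⟨p, hp⟩ := walk_le v hj (j - k) k w (by omega) hk
    exact ⟨p.reverse, by rw [Walk.length_reverse, hp, ell_comm]⟩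

lemma GX_dist_le {d : ℕ} (v w : VV d) : ((GX d).dist v w : ℤ) ≤ ell v.1 w.1 := by
  obtain ⟨p, hp⟩ := walk_ell v w
  rw [← hp]; exact_mod_cast SimpleGraph.dist_le p

lemma GX_conn (d : ℕ) : (GX d).Connected :=
  haveI : Nonempty (VV d) := ⟨cpt d 0⟩
  ⟨fun v w => let ⟨p, _⟩ := walk_ell v w; ⟨p⟩⟩

lemma GY_conn (d : ℕ) (i j : Fin d) (hij : i ≠ j) : (GY d i j).Connected :=
  (GX_conn d).mono (GX_le_GY d i j hij)

lemma GY_dist_le {d : ℕ} (i j : Fin d) (hij : i ≠ j) (v w : VV d) :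
    (GY d i j).dist v w ≤ (GX d).dist v w := by
  obtain ⟨p, hp⟩ := (GX_conn d).exists_walk_length_eq_dist v w
  rw [← hp, ← Walk.length_map (Hom.ofLE (GX_le_GY d i j hij)) p]
  exact SimpleGraph.dist_le _

/-- Functions that are Lipschitz along edges are Lipschitz for the graph distance. -/
lemma lip_dist {V : Type*} (G : SimpleGraph V) (hG : G.Connected) (h : V → ℤ) (L : ℤ)
    (hL : ∀ v w, G.Adj v w → h w ≤ h v + L) (v w : V) : h w - h v ≤ L * G.dist v w := by
  have key : ∀ (v w : V) (p : G.Walk v w), h w - h v ≤ L * p.length := by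
    intro v w p
    induction p with
    | nil => simp
    | cons hadj p ih =>
      have := hL _ _ hadj
      rw [Walk.length_cons]; push_cast; linarith
  obtain ⟨p, hp⟩ := hG.exists_walk_length_eq_dist v w
  rw [← hp]; exact key v w p

lemma oned (p : ℤ → Prop) (b : ℤ) (hb : ¬ p b) (n : ℕ) : ∀ a : ℤ, (b - a).natAbs = n → p a →
    ∃ t t', min a b ≤ t ∧ t ≤ max a b ∧ min a b ≤ t' ∧ t' ≤ max a b ∧ (t - t').natAbs = 1 ∧
      p t ∧ ¬ p t' := by
  induction n with
  | zero =>
    intro a h ha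
    have : a = b := by omega
    subst this; exact absurd ha hb
  | succ n ih =>
    intro a h ha
    obtain ⟨a', h1, h2, h3, h4⟩ : ∃ a', (a - a').natAbs = 1 ∧ (b - a').natAbs = n ∧
        min a b ≤ a' ∧ a' ≤ max a b := by
      rcases le_total a b with hab | hab
      · refine ⟨a + 1, ?_, ?_, ?_, ?_⟩ <;> omega
      · refine ⟨a - 1, ?_, ?_, ?_, ?_⟩ <;> omega
    by_cases hp : p a'
    · obtain ⟨t, t', g1, g2, g3, g4, g5, g6, g7⟩ := ih a' h2 hp
      refine ⟨t, t', ?_, ?_, ?_, ?_, g5, g6, g7⟩ <;> omega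
    · refine ⟨a, a', ?_, ?_, h3, h4, h1, ha, hp⟩ <;> omega

lemma card_box {d : ℕ} (q : Fin d → ℤ) (s : ℕ) :
    (Finset.Icc q (fun i => q i + s)).card = (s + 1) ^ d := by
  rw [Pi.card_Icc]
  have : ∀ i : Fin d, (Finset.Icc (q i) (q i + s)).card = s + 1 := by
    intro i; rw [Int.card_Icc]; omega
  simp [this]

/-- Relative isoperimetry: a set containing a cube and missing a translate of it has a large
boundary. -/
lemma iso {d : ℕ} (hd : 0 < d) (S U : Set (Fin d → ℤ)) (hU : U.Finite) (lo hi : ℤ) (q v : Fin d → ℤ) (s : ℕ)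
    (hq : ∀ i, lo ≤ q i ∧ q i + s ≤ hi) (hqv : ∀ i, lo ≤ q i + v i ∧ q i + v i + s ≤ hi)
    (hS : ∀ z : Fin d → ℤ, (∀ i, q i ≤ z i ∧ z i ≤ q i + s) → z ∈ S)
    (hR : ∀ z : Fin d → ℤ, (∀ i, q i + v i ≤ z i ∧ z i ≤ q i + v i + s) → z ∉ S)
    (hb : ∀ (u : Fin d → ℤ) (i : Fin d) (t : ℤ), (∀ l, lo ≤ u l ∧ u l ≤ hi) → lo ≤ t → t ≤ hi →
      |u i - t| = 1 → u ∈ S → Function.update u i t ∉ S → u ∈ U) :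
    (s + 1) ^ d ≤ U.ncard * (d * (s + 1)) := by
  have key : ∀ z : Fin d → ℤ, (∀ i, q i ≤ z i ∧ z i ≤ q i + s) → ∃ (u : Fin d → ℤ) (j : Fin d),
      u ∈ U ∧ (∀ l, l < j → u l = z l + v l) ∧ (∀ l, j < l → u l = z l) := by
    intro z hz
    let w : ℕ → Fin d → ℤ := fun j i => if i.val < j then z i + v i else z i
    have hwd : w d ∉ S := by
      apply hR
      intro i
      have := hz i
      simp only [w, i.2, if_true]
      constructor <;> linarith
    have hex : ∃ j, w j ∉ S := ⟨d, hwd⟩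
    classical
    let m := Nat.find hex
    have hm : w m ∉ S := Nat.find_spec hex
    have hm0 : m ≠ 0 := by
      intro h0
      rw [h0] at hm
      apply hm
      apply hS
      intro i; simpa [w] using hz i
    have hmd : m ≤ d := Nat.find_min' hex hwd
    obtain ⟨j, hj⟩ : ∃ j, m = j + 1 := ⟨m - 1, by omega⟩
    have hjS : w j ∈ S := by
      by_contra hc
      have := Nat.find_min' hex hc
      change m ≤ j at this
      omega
    have hjd : j < d := by omega
    let J : Fin d := ⟨j, hjd⟩
    have e1 : Function.update (w j) J (z J) = w j := by
      funext i
      by_cases hi : i = J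
      · subst hi; simp [w, J]
      · simp [hi]
    have e2 : Function.update (w j) J (z J + v J) = w m := by
      funext i
      by_cases hi : i = J
      · subst hi; simp [w, J, hj]
      · have : i.val ≠ j := fun h => hi (Fin.ext h)
        simp only [Function.update_of_ne hi, w, hj]
        by_cases h1 : i.val < j
        · simp [h1, Nat.lt_succ_of_lt h1]
        · have : ¬ i.val < j + 1 := by omega
          simp [h1, this]
    obtain ⟨t, t', g1, g2, g3, g4, g5, g6, g7⟩ :=
      oned (fun t => Function.update (w j) J t ∈ S) (z J + v J) (by rw [e2]; exact hm) _ (z J) rfl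
        (by rw [e1]; exact hjS)
    have hzJ := hz J
    have hqJ := hq J
    have hqvJ := hqv J
    refine ⟨Function.update (w j) J t, J, ?_, ?_, ?_⟩
    · refine hb _ J t' ?_ ?_ ?_ ?_ g6 ?_
      · intro l
        by_cases hl : l = J
        · subst hl
          simp only [Function.update_self]
          constructor <;> omega
        · simp only [Function.update_of_ne hl, w]
          have := hz l
          have := hq l
          have := hqv l
          split_ifs <;> constructor <;> linarith
      · omega
      · omega
      · rw [Function.update_self, Int.abs_eq_natAbs, g5]; rfl
      · simpa using g7
    · intro l hl
      have h2 : l.val < j := hl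
      simp [Function.update_of_ne hl.ne, w, h2]
    · intro l hl
      have h2 : ¬ l.val < j := by
        have : j < l.val := hl
        omega
      simp [Function.update_of_ne hl.ne', w, h2]
  have : Nonempty (Fin d) := ⟨⟨0, hd⟩⟩
  choose! u j hu using key
  rw [← card_box q s]
  have hcard : (hU.toFinset ×ˢ ((Finset.univ : Finset (Fin d)) ×ˢ Finset.range (s + 1))).card =
      U.ncard * (d * (s + 1)) := by
    simp [Finset.card_product, Set.ncard_eq_toFinset_card U hU]
  rw [← hcard]
  have hP : ∀ z, z ∈ Finset.Icc q (fun i => q i + (s:ℤ)) → ∀ i, q i ≤ z i ∧ z i ≤ q i + s := by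
    intro z hz i
    rw [Finset.mem_Icc] at hz
    exact ⟨hz.1 i, hz.2 i⟩
  apply Finset.card_le_card_of_injOn (fun z => (u z, j z, (z (j z) - q (j z)).toNat))
  · intro z hz
    have hz' := hP z hz
    have h1 := hz' (j z)
    simp only [Finset.coe_product, Set.mem_prod, Finset.mem_coe, Finset.mem_univ, true_and,
      Finset.mem_range, Set.Finite.mem_toFinset]
    exact ⟨(hu z hz').1, by omega⟩
  · intro z hz y hy hzy
    have hz' := hP z hz
    have hy' := hP y hy
    simp only [Prod.mk.injEq] at hzy
    obtain ⟨a1, a2, a3⟩ := hzy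
    obtain ⟨_, b1, b2⟩ := hu z hz'
    obtain ⟨_, c1, c2⟩ := hu y hy'
    rw [← a2] at c1 c2 a3
    rw [← a1] at c1 c2
    funext l
    rcases lt_trichotomy l (j z) with h | h | h
    · have := b1 l h
      have := c1 l h
      linarith
    · subst h
      have h1 := hz' (j z)
      have h2 := hy' (j z)
      omega
    · rw [← b2 l h, ← c2 l h]

lemma ncard_ge {d : ℕ} (T : Set (VV d)) (hT : T.Finite) (q : Fin d → ℤ) (s : ℕ)
    (h : ∀ z : Fin d → ℤ, (∀ i, q i ≤ z i ∧ z i ≤ q i + s) → ∃ y ∈ T, y.1 = z) :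
    (s + 1) ^ d ≤ T.ncard := by
  rw [← card_box q s, ← Set.ncard_image_of_injective T Subtype.val_injective, ← Set.ncard_coe_finset]
  apply Set.ncard_le_ncard _ (hT.image _)
  intro z hz
  rw [Finset.mem_coe, Finset.mem_Icc] at hz
  exact h z fun i => ⟨hz.1 i, hz.2 i⟩

lemma GY_coord {d : ℕ} (i j : Fin d) (hij : i ≠ j) (x y : VV d) (l : Fin d) :
    |x.1 l - y.1 l| ≤ 4 * (GY d i j).dist x y := by
  have h1 := lip_dist (GY d i j) (GY_conn d i j hij) (fun v => v.1 l) 4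
    (fun v w h => by have := h.2.2.2 l; grind) x y
  have h2 := lip_dist (GY d i j) (GY_conn d i j hij) (fun v => - v.1 l) 4
    (fun v w h => by have := h.2.2.2 l; grind) x y
  rw [abs_le]
  constructor <;> linarith

lemma ball_up {d : ℕ} (i j : Fin d) (hij : i ≠ j) (x : VV d) (r : ℕ) :
    (gBall (GY d i j) x r).Finite ∧ (gBall (GY d i j) x r).ncard ≤ (8 * r + 1) ^ d := by
  have hsub : Subtype.val '' (gBall (GY d i j) x r) ⊆
      ((Finset.Icc (fun l => x.1 l - 4 * r) (fun l => (x.1 l - 4 * r) + (8 * r : ℕ)) :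
        Finset (Fin d → ℤ)) : Set (Fin d → ℤ)) := by
    rintro _ ⟨y, hy, rfl⟩
    have h1 : ∀ l, |x.1 l - y.1 l| ≤ 4 * r := fun l => by
      have := GY_coord i j hij x y l
      have h2 : (GY d i j).dist x y ≤ r := hy
      have h3 : ((GY d i j).dist x y : ℤ) ≤ r := by exact_mod_cast h2
      linarith
    rw [Finset.mem_coe, Finset.mem_Icc]
    constructor <;> intro l <;> have := h1 l <;> rw [abs_le] at this <;> push_cast <;>
      linarith
  have hf := Set.Finite.subset (Finset.finite_toSet _) hsub
  refine ⟨hf.of_finite_image Subtype.val_injective.injOn, ?_⟩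
  rw [← Set.ncard_image_of_injective _ Subtype.val_injective]
  refine (Set.ncard_le_ncard hsub (Finset.finite_toSet _)).trans ?_
  rw [Set.ncard_coe_finset, card_box]

lemma gBall_sub {d : ℕ} (i j : Fin d) (hij : i ≠ j) (x : VV d) (r : ℕ) :
    gBall (GX d) x r ⊆ gBall (GY d i j) x r := fun y hy =>
  (GY_dist_le i j hij x y).trans hy

lemma subcube {d k : ℕ} (x : Fin d → ℤ) (hx : x ∈ cube d k) (s : ℕ) (hs : (s : ℤ) ≤ 2 ^ k) :
    ∃ q : Fin d → ℤ, (∀ i, 8 * 2 ^ k ≤ q i ∧ q i + s ≤ 16 * 2 ^ k) ∧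
      ∀ z : Fin d → ℤ, (∀ i, q i ≤ z i ∧ z i ≤ q i + s) → ∀ i, |x i - z i| ≤ s := by
  refine ⟨fun i => if x i + s ≤ 16 * 2 ^ k then x i else x i - s, ?_, ?_⟩
  · intro i
    have := hx i
    have : (0:ℤ) < 2 ^ k := by positivity
    simp only
    split_ifs <;> constructor <;> linarith
  · intro z hz i
    have := hz i
    simp only at this
    rw [abs_le]
    split_ifs at this <;> constructor <;> linarith

lemma ball_low {d : ℕ} (i j : Fin d) (hij : i ≠ j) (hd : 0 < d) (x : VV d) (r : ℕ) :
    ∃ s : ℕ, r + 1 ≤ 32 * d * (s + 1) ∧ (s + 1) ^ d ≤ (gBall (GX d) x r).ncard := by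
  have hfin : (gBall (GX d) x r).Finite := (ball_up i j hij x r).1.subset (gBall_sub i j hij x r)
  obtain ⟨n, hn⟩ := x.2
  have hex : ∃ m, r < 32 * d * 2 ^ (n + m) := ⟨r, by
    have h1 : r < 2 ^ r := Nat.lt_two_pow_self
    have h2 : 2 ^ r ≤ 2 ^ (n + r) := Nat.pow_le_pow_right (by norm_num) (by omega)
    nlinarith⟩
  classical
  have hspec := Nat.find_spec hex
  have hmin : ∀ m, m < Nat.find hex → ¬ _ := fun m hm => Nat.find_min hex hm
  set m := Nat.find hex
  rcases Nat.eq_zero_or_pos m with h0 | hpos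
  · rw [h0, add_zero] at hspec
    refine ⟨min (r / d) (2 ^ n), ?_, ?_⟩
    · rcases le_total (r / d) (2 ^ n) with h | h
      · rw [min_eq_left h]
        have := Nat.lt_mul_div_succ r hd
        nlinarith
      · rw [min_eq_right h]
        nlinarith
    · have hsn : ((min (r / d) (2 ^ n) : ℕ) : ℤ) ≤ 2 ^ n := by
        exact_mod_cast min_le_right _ _
      obtain ⟨q, hq1, hq2⟩ := subcube x.1 hn (min (r / d) (2 ^ n)) hsn
      refine ncard_ge _ hfin q _ fun z hz => ?_
      have hzc : z ∈ cube d n := fun i => by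
        have := hz i
        have := hq1 i
        constructor <;> linarith
      refine ⟨⟨z, n, hzc⟩, ?_, rfl⟩
      have h1 := GX_dist_le x ⟨z, n, hzc⟩
      have h2 := ell_le _ _ _ (hq2 z hz)
      have h3 : d * min (r / d) (2 ^ n) ≤ r :=
        (Nat.mul_le_mul_left d (min_le_left _ _)).trans (Nat.mul_div_le r d)
      have h4 : ((d * min (r / d) (2 ^ n) : ℕ) : ℤ) ≤ r := by exact_mod_cast h3
      have h5 : ((GX d).dist x ⟨z, n, hzc⟩ : ℤ) ≤ r := by
        rw [Nat.cast_mul] at h4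
        exact h1.trans (h2.trans h4)
      exact_mod_cast h5
  · have h1 := hmin (m - 1) (by omega)
    have h2 : n + m = (n + (m - 1)) + 1 := by omega
    have h3 : 16 * d * 2 ^ (n + m) ≤ r := by
      rw [h2, pow_succ]
      nlinarith
    refine ⟨2 ^ (n + m), by nlinarith, ?_⟩
    refine ncard_ge _ hfin (cpt d (n + m)).1 _ fun z hz => ?_
    have hp : (0:ℤ) < 2 ^ n := by positivity
    have hp2 : (2:ℤ) ^ n ≤ 2 ^ (n + m) := pow_le_pow_right₀ (by norm_num) (by omega)
    have hzc : z ∈ cube d (n + m) := fun i => by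
      have := hz i
      simp only [cpt] at this
      push_cast at this
      constructor <;> linarith
    refine ⟨⟨z, n + m, hzc⟩, ?_, rfl⟩
    have h4 := GX_dist_le x ⟨z, n + m, hzc⟩
    have h5 := ell_le x.1 z (16 * 2 ^ (n + m)) (fun i => by
      have := hzc i
      have := hn i
      rw [abs_le]
      constructor <;> linarith)
    have h6 : ((16 * d * 2 ^ (n + m) : ℕ) : ℤ) ≤ r := by exact_mod_cast h3
    push_cast at h6
    have h7 : ((GX d).dist x ⟨z, n + m, hzc⟩ : ℤ) ≤ r := by
      refine h4.trans (h5.trans ?_)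
      linarith
    exact_mod_cast h7

/-- The union of the first cubes. -/
def AA (d n : ℕ) : Set (VV d) := {v | ∀ i, v.1 i ≤ 8 * 2 ^ n}

lemma out_cube {d n k : ℕ} {w : VV d} (hw : w.1 ∈ cube d k) (hwA : w ∉ AA d n) : n ≤ k := by
  by_contra hc
  apply hwA
  intro i
  have h1 : (2:ℤ) ^ (k + 1) ≤ 2 ^ n := pow_le_pow_right₀ (by norm_num) (by omega)
  have := (hw i).2
  rw [pow_succ] at h1
  linarith

lemma cut {d n k : ℕ} {v w : VV d} (hv : v.1 ∈ cube d k) (hw : w.1 ∈ cube d k) (hvA : v ∈ AA d n)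
    (hwA : w ∉ AA d n) : v = cpt d n := by
  have h1 : (2:ℤ) ^ n ≤ 2 ^ k := pow_le_pow_right₀ (by norm_num) (out_cube hw hwA)
  apply Subtype.ext; funext i
  have := hvA i
  have := (hv i).1
  simp only [cpt]
  linarith

lemma dist_le_one {V : Type*} {G : SimpleGraph V} (hG : G.Connected) {v w : V} (h : G.dist v w ≤ 1) :
    v = w ∨ G.Adj v w := by
  rcases Nat.le_one_iff_eq_zero_or_eq_one.1 h with h | h
  · exact Or.inl (hG.dist_eq_zero_iff.1 h)
  · exact Or.inr (SimpleGraph.dist_eq_one_iff_adj.1 h)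

lemma AA_bdry {d : ℕ} (n : ℕ) (G : SimpleGraph (VV d)) (hG : G.Connected)
    (hc : ∀ v w, G.Adj v w → ∃ k, v.1 ∈ cube d k ∧ w.1 ∈ cube d k) :
    gBdry G (AA d n) ⊆ gBall G (cpt d n) 1 := by
  rintro y ⟨⟨a, ha, hya⟩, ⟨b, hb, hyb⟩⟩
  change G.dist (cpt d n) y ≤ 1
  by_cases hy : y ∈ AA d n
  · rcases dist_le_one hG hyb with h | h
    · subst h; exact absurd hy hb
    · obtain ⟨k, h1, h2⟩ := hc _ _ h
      rw [← cut h1 h2 hy hb]; simp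
  · rcases dist_le_one hG hya with h | h
    · subst h; exact absurd ha hy
    · obtain ⟨k, h1, h2⟩ := hc _ _ h
      rw [← cut h2 h1 ha hy, SimpleGraph.dist_comm]; exact hya

lemma AA_eq_ball {d : ℕ} (n : ℕ) :
    AA d n = gBall (GX d) (cpt d 0) (d * (8 * 2 ^ n - 8)) := by
  have hp : 1 ≤ 2 ^ n := Nat.one_le_two_pow
  have hcast : ((d * (8 * 2 ^ n - 8) : ℕ) : ℤ) = d * (8 * 2 ^ n - 8) := by
    push_cast [Nat.cast_sub (show 8 ≤ 8 * 2 ^ n by omega)]; ring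
  have hge : ∀ (y : VV d) (i : Fin d), 8 ≤ y.1 i := by
    intro y i
    obtain ⟨k, hk⟩ := y.2
    have := (hk i).1
    have : (0:ℤ) < 2 ^ k := by positivity
    linarith
  ext y
  constructor
  · intro hy
    have h1 := GX_dist_le (cpt d 0) y
    have h2 := ell_le (cpt d 0).1 y.1 (8 * 2 ^ n - 8) (fun i => by
      have := hge y i
      have := hy i
      simp only [cpt]
      rw [abs_le]
      constructor <;> linarith)
    have h3 : ((GX d).dist (cpt d 0) y : ℤ) ≤ ((d * (8 * 2 ^ n - 8) : ℕ) : ℤ) := by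
      rw [hcast]; exact h1.trans h2
    exact_mod_cast h3
  · intro hy
    by_contra hyA
    have hy' : ((GX d).dist (cpt d 0) y : ℤ) ≤ ((d * (8 * 2 ^ n - 8) : ℕ) : ℤ) := by
      exact_mod_cast hy
    rw [hcast] at hy'
    have h1 := lip_dist (GX d) (GX_conn d) (fun v => ∑ i, v.1 i) 1 (fun v w h => by
      have h2 := h.2
      have h3 : ∑ i, w.1 i - ∑ i, v.1 i ≤ ell v.1 w.1 := by
        rw [← Finset.sum_sub_distrib]
        refine Finset.sum_le_sum fun i _ => ?_
        rw [abs_sub_comm]; exact le_abs_self _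
      linarith) (cpt d 0) y
    obtain ⟨k, hk⟩ := y.2
    have h4 : (2:ℤ) ^ n ≤ 2 ^ k := pow_le_pow_right₀ (by norm_num) (out_cube hk hyA)
    obtain ⟨i, hi⟩ : ∃ i, 8 * 2 ^ n < y.1 i := by
      by_contra! hc
      exact hyA hc
    have h5 : ∑ i : Fin d, (8 * 2 ^ n : ℤ) < ∑ i, y.1 i :=
      Finset.sum_lt_sum (fun l _ => by have := (hk l).1; linarith) ⟨i, Finset.mem_univ i, hi⟩
    have h6 : ∑ i, (cpt d 0).1 i = d * 8 := by simp [cpt]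
    simp only [h6] at h1
    simp at h5
    linarith

lemma diag {d : ℕ} (i j : Fin d) (hij : i ≠ j) (k m : ℕ) : ∀ v : VV d, v.1 ∈ cube d k →
    v.1 i = v.1 j → (∀ l, 16 * 2 ^ k - v.1 l ≤ 4 * m) → (GY d i j).dist v (cpt d (k + 1)) ≤ m := by
  induction m with
  | zero =>
    intro v hv hf h
    have : v = cpt d (k + 1) := by
      apply Subtype.ext; funext l
      have := h l
      have := (hv l).2
      simp only [cpt, pow_succ]
      push_cast at *
      linarith
    subst this; simp
  | succ m ih =>
    intro v hv hf h
    have hm : (fun l => min (v.1 l + 4) (16 * 2 ^ k)) ∈ cube d k := by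
      intro l
      have := hv l
      exact ⟨le_min (by linarith) (by linarith), min_le_right _ _⟩
    have h1 := ih ⟨_, k, hm⟩ hm (by simp only [hf]) (fun l => by
      have := h l
      push_cast at this
      simp only
      rcases min_choice (v.1 l + 4) (16 * 2 ^ k) with h2 | h2 <;> rw [h2]
      · linarith
      · simp)
    have h2 : (GY d i j).dist v ⟨_, k, hm⟩ ≤ 1 := by
      by_cases he : v = ⟨_, k, hm⟩
      · rw [← he]; simp
      · refine (SimpleGraph.dist_eq_one_iff_adj.2 ?_).le
        refine (⟨he, ⟨k, hv, hm⟩, ?_, ?_⟩ : (GY d i j).Adj v ⟨_, k, hm⟩)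
        · simp only [hf]; simp
        · intro l
          have := hv l
          simp only
          rcases min_cases (v.1 l + 4) (16 * 2 ^ k) with h2 | h2 <;> rw [h2.1, abs_le] <;>
            constructor <;> linarith
    have := (GY_conn d i j hij).dist_triangle (u := v) (v := ⟨_, k, hm⟩) (w := cpt d (k + 1))
    omega

lemma gate {d : ℕ} (i j : Fin d) (hij : i ≠ j) (k : ℕ) (x : VV d) (hx : x.1 ∈ cube d k) :
    ((GY d i j).dist x (cpt d (k + 1)) : ℤ) ≤ |x.1 i - x.1 j| + 2 * 2 ^ k := by
  have key : ∃ y : VV d, y.1 ∈ cube d k ∧ y.1 i = y.1 j ∧ ell x.1 y.1 ≤ |x.1 i - x.1 j| := by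
    have hm : ∀ a b : Fin d, Function.update x.1 a (x.1 b) ∈ cube d k := by
      intro a b l
      by_cases hl : l = a
      · subst hl; simpa using hx b
      · simpa [hl] using hx l
    refine ⟨⟨_, k, hm i j⟩, hm i j, ?_, ?_⟩
    · simp [hij.symm]
    · simp only [ell_update]; exact le_rfl
  obtain ⟨y, hy, hyf, hye⟩ := key
  have h1 := GX_dist_le x y
  have h2 := GY_dist_le i j hij x y
  have h3 := diag i j hij k (2 * 2 ^ k) y hy hyf (fun l => by
    have := (hy l).1
    push_cast
    linarith)
  have h4 := (GY_conn d i j hij).dist_triangle (u := x) (v := y) (w := cpt d (k + 1))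
  have h5 : ((GY d i j).dist x (cpt d (k + 1)) : ℤ) ≤ (GX d).dist x y + ((2 * 2 ^ k : ℕ) : ℤ) := by
    exact_mod_cast (by omega)
  push_cast at h5
  linarith

lemma far {d : ℕ} (i j : Fin d) (hij : i ≠ j) (k : ℕ) (x y : VV d) (hx : x ∈ AA d k)
    (hy : y ∉ AA d k) :
    ((GY d i j).dist x (cpt d k) : ℤ) + |y.1 i - y.1 j| ≤ (GY d i j).dist x y := by
  classical
  have hG := GY_conn d i j hij
  have h1 := lip_dist (GY d i j) hG (fun v => if v ∈ AA d k then ((GY d i j).dist x v : ℤ)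
    else (GY d i j).dist x (cpt d k) + |v.1 i - v.1 j|) 1 (fun v w h => by
      have hd1 : (GY d i j).dist v w = 1 := SimpleGraph.dist_eq_one_iff_adj.2 h
      have ht := hG.dist_triangle (u := x) (v := v) (w := w)
      have hf := h.2.2.1
      obtain ⟨n, hn1, hn2⟩ := h.2.1
      by_cases hv : v ∈ AA d k <;> by_cases hw : w ∈ AA d k
      · simp only [hv, hw, if_true]; omega
      · simp only [hv, hw, if_true, if_false]
        have := cut hn1 hn2 hv hw
        subst this
        simp [cpt] at hf ⊢
        rw [abs_sub_comm]; exact hf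
      · simp only [hv, hw, if_true, if_false]
        have := cut hn2 hn1 hw hv
        subst this
        have := abs_nonneg (v.1 i - v.1 j)
        omega
      · simp only [hv, hw, if_false]
        have := abs_sub_abs_le_abs_sub (w.1 i - w.1 j) (v.1 i - v.1 j)
        rw [abs_sub_comm] at hf
        linarith) x y
  simp only [hx, hy, if_true, if_false, SimpleGraph.dist_self] at h1
  push_cast at h1
  linarith

lemma isoV {d : ℕ} (hd : 0 < d) (i j : Fin d) (hij : i ≠ j) (x : VV d) (r k s : ℕ)
    (q q' : Fin d → ℤ)
    (hq : ∀ l, 8 * 2 ^ k ≤ q l ∧ q l + s ≤ 16 * 2 ^ k)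
    (hq' : ∀ l, 8 * 2 ^ k ≤ q' l ∧ q' l + s ≤ 16 * 2 ^ k)
    (hS : ∀ y : VV d, (∀ l, q l ≤ y.1 l ∧ y.1 l ≤ q l + s) → (GY d i j).dist x y ≤ r)
    (hR : ∀ y : VV d, (∀ l, q' l ≤ y.1 l ∧ y.1 l ≤ q' l + s) → r < (GY d i j).dist x y) :
    (s + 1) ^ d ≤ (gBdry (GY d i j) (gBall (GY d i j) x r)).ncard * (d * (s + 1)) := by
  have hG := GY_conn d i j hij
  have hfin : (gBdry (GY d i j) (gBall (GY d i j) x r)).Finite := by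
    refine (ball_up i j hij x (r + 1)).1.subset ?_
    rintro y ⟨⟨a, ha, hya⟩, _⟩
    have := hG.dist_triangle (u := x) (v := a) (w := y)
    rw [SimpleGraph.dist_comm] at hya
    change (GY d i j).dist x a ≤ r at ha
    change (GY d i j).dist x y ≤ r + 1
    omega
  have hmem : ∀ p : Fin d → ℤ, (∀ l, 8 * 2 ^ k ≤ p l ∧ p l + s ≤ 16 * 2 ^ k) → ∀ z : Fin d → ℤ,
      (∀ l, p l ≤ z l ∧ z l ≤ p l + s) → z ∈ cube d k := by
    intro p hp z hz l
    have := hp l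
    have := hz l
    constructor <;> linarith
  rw [← Set.ncard_image_of_injective _ Subtype.val_injective]
  refine iso hd (Subtype.val '' gBall (GY d i j) x r) _ (hfin.image _) (8 * 2 ^ k) (16 * 2 ^ k) q
    (fun l => q' l - q l) s hq ?_ ?_ ?_ ?_
  · intro l
    have := hq' l
    constructor <;> linarith
  · intro z hz
    exact ⟨⟨z, k, hmem q hq z hz⟩, hS _ hz, rfl⟩
  · rintro _ hz ⟨y, hy, rfl⟩
    have h1 := hR y (fun l => by have := hz l; constructor <;> linarith)
    change (GY d i j).dist x y ≤ r at hy
    omega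
  · rintro _ l t hu ht1 ht2 hut ⟨u, hub, rfl⟩ hun
    refine ⟨u, ⟨⟨u, hub, by simp⟩, ?_⟩, rfl⟩
    have hm : Function.update u.1 l t ∈ cube d k := by
      intro a
      by_cases ha : a = l
      · subst ha; simpa using ⟨ht1, ht2⟩
      · simpa [ha] using hu a
    refine ⟨⟨_, k, hm⟩, fun hc => hun ⟨_, hc, rfl⟩, ?_⟩
    apply (SimpleGraph.dist_eq_one_iff_adj.2 _).le
    apply GX_le_GY d i j hij
    exact ⟨⟨k, hu, hm⟩, by rw [ell_update]; exact hut⟩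

lemma main_low {d : ℕ} (hd : 2 ≤ d) (i j : Fin d) (hij : i ≠ j) (x : VV d) (r : ℕ) :
    ∃ s : ℕ, r + 1 ≤ 12 * d ^ 2 * (s + 1) ∧
      (s + 1) ^ d ≤ (gBdry (GY d i j) (gBall (GY d i j) x r)).ncard * (d * (s + 1)) := by
  have hG := GY_conn d i j hij
  have hd0 : 0 < d := by omega
  obtain ⟨n, hn⟩ := x.2
  have hex : ∃ m, r < (GY d i j).dist x (cpt d (n + m + 1)) + 2 ^ (n + m + 1) := ⟨r, by
    have h1 : r < 2 ^ r := Nat.lt_two_pow_self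
    have h2 : 2 ^ r ≤ 2 ^ (n + r + 1) := Nat.pow_le_pow_right (by norm_num) (by omega)
    omega⟩
  classical
  have hspec := Nat.find_spec hex
  have hmin : ∀ m, m < Nat.find hex → ¬ _ := fun m hm => Nat.find_min hex hm
  set m := Nat.find hex
  rcases Nat.eq_zero_or_pos m with h0 | hpos
  · rw [h0, add_zero] at hspec
    have hg := gate i j hij n x hn
    have hu : (0:ℤ) < 2 ^ n := by positivity
    have hr : (r : ℤ) < |x.1 i - x.1 j| + 4 * 2 ^ n := by
      have : (r : ℤ) < ((GY d i j).dist x (cpt d (n + 1)) : ℤ) + 2 ^ (n + 1) := by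
        exact_mod_cast hspec
      rw [pow_succ] at this
      linarith
    have hfx : |x.1 i - x.1 j| ≤ 8 * 2 ^ n := by
      have := hn i
      have := hn j
      rw [abs_le]; constructor <;> linarith
    have hr12 : r < 12 * 2 ^ n := by
      have : (r : ℤ) < 12 * 2 ^ n := by linarith
      exact_mod_cast this
    obtain ⟨s, hsr, hsn, hs3⟩ : ∃ s : ℕ, d * s ≤ r ∧ s ≤ 2 ^ n ∧ r + 1 ≤ 12 * d ^ 2 * (s + 1) := by
      refine ⟨min (r / d) (2 ^ n),
        (Nat.mul_le_mul_left d (min_le_left _ _)).trans (Nat.mul_div_le r d), min_le_right _ _, ?_⟩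
      have hdd : d ≤ d ^ 2 := by nlinarith
      rcases le_total (r / d) (2 ^ n) with h | h
      · rw [min_eq_left h]
        have := Nat.lt_mul_div_succ r hd0
        nlinarith
      · rw [min_eq_right h]
        nlinarith
    have hsnZ : (s : ℤ) ≤ 2 ^ n := by exact_mod_cast hsn
    refine ⟨s, hs3, ?_⟩
    obtain ⟨q, hq1, hq2⟩ := subcube x.1 hn s hsnZ
    have hS : ∀ y : VV d, (∀ l, q l ≤ y.1 l ∧ y.1 l ≤ q l + s) → (GY d i j).dist x y ≤ r := by
      intro y hy
      have h1 := GX_dist_le x y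
      have h2 := ell_le _ _ _ (hq2 y.1 hy)
      have h3 : ((GX d).dist x y : ℤ) ≤ ((d * s : ℕ) : ℤ) := by push_cast; linarith
      have h4 : (GX d).dist x y ≤ d * s := by exact_mod_cast h3
      exact (GY_dist_le i j hij x y).trans (h4.trans hsr)
    have hlip : ∀ y : VV d, |(y.1 i - y.1 j) - (x.1 i - x.1 j)| ≤ (GY d i j).dist x y := by
      intro y
      have h1 := lip_dist (GY d i j) hG (fun v => v.1 i - v.1 j) 1
        (fun v w h => by have := abs_le.1 h.2.2.1; linarith) x y
      have h2 := lip_dist (GY d i j) hG (fun v => -(v.1 i - v.1 j)) 1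
        (fun v w h => by have := abs_le.1 h.2.2.1; linarith) x y
      rw [abs_le]
      constructor <;> linarith
    rcases le_total (x.1 i - x.1 j) 0 with hf | hf
    · refine isoV hd0 i j hij x r n s q (fun l => if l = i then 16 * 2 ^ n - s else 8 * 2 ^ n) hq1
        ?_ hS ?_
      · intro l
        split_ifs <;> constructor <;> linarith
      · intro y hy
        have h1 := hy i
        have h2 := hy j
        simp only [hij.symm, if_true, if_false] at h1 h2
        have h3 := (le_abs_self _).trans (hlip y)
        rw [abs_of_nonpos hf] at hr
        have : (r : ℤ) < (GY d i j).dist x y := by linarith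
        exact_mod_cast this
    · refine isoV hd0 i j hij x r n s q (fun l => if l = j then 16 * 2 ^ n - s else 8 * 2 ^ n) hq1
        ?_ hS ?_
      · intro l
        split_ifs <;> constructor <;> linarith
      · intro y hy
        have h1 := hy i
        have h2 := hy j
        simp only [hij, if_true, if_false] at h1 h2
        have h3 := (neg_le_abs _).trans (hlip y)
        rw [abs_of_nonneg hf] at hr
        have : (r : ℤ) < (GY d i j).dist x y := by linarith
        exact_mod_cast this
  · have h1 := hmin (m - 1) (by omega)
    have h2 : n + (m - 1) + 1 = n + m := by omega
    rw [h2] at h1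
    push Not at h1
    have hnk : n + 1 ≤ n + m := by omega
    generalize n + m = k at *
    have hu : (0:ℤ) < 2 ^ k := by positivity
    have hxA : x ∈ AA d k := by
      intro l
      have h3 : (2:ℤ) ^ (n + 1) ≤ 2 ^ k := pow_le_pow_right₀ (by norm_num) hnk
      have := (hn l).2
      rw [pow_succ] at h3
      linarith
    have hg := gate i j hij k (cpt d k) (cpt_mem d k)
    have ht := hG.dist_triangle (u := x) (v := cpt d k) (w := cpt d (k + 1))
    have hr : (r : ℤ) < (GY d i j).dist x (cpt d k) + 4 * 2 ^ k := by
      have h3 : (r : ℤ) < ((GY d i j).dist x (cpt d (k + 1)) : ℤ) + 2 ^ (k + 1) := by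
        exact_mod_cast hspec
      have ht' : ((GY d i j).dist x (cpt d (k + 1)) : ℤ) ≤
        (GY d i j).dist x (cpt d k) + (GY d i j).dist (cpt d k) (cpt d (k + 1)) := by exact_mod_cast ht
      simp only [cpt, sub_self, abs_zero] at hg
      rw [pow_succ] at h3
      simp only [cpt] at *
      linarith
    have hD : ((GY d i j).dist x (cpt d k) : ℤ) ≤ d * (8 * 2 ^ k) := by
      have g1 := GX_dist_le x (cpt d k)
      have g2 := GY_dist_le i j hij x (cpt d k)
      have g3 := ell_le x.1 (cpt d k).1 (8 * 2 ^ k) (fun l => by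
        have := hxA l
        have := (hn l).1
        have : (0:ℤ) < 2 ^ n := by positivity
        simp only [cpt]
        rw [abs_le]; constructor <;> linarith)
      have g4 : ((GY d i j).dist x (cpt d k) : ℤ) ≤ (GX d).dist x (cpt d k) := by exact_mod_cast g2
      linarith
    have hr' : r < d * (8 * 2 ^ k) + 4 * 2 ^ k := by
      have : (r : ℤ) < d * (8 * 2 ^ k) + 4 * 2 ^ k := by linarith
      exact_mod_cast this
    obtain ⟨s, hs1, hs2⟩ : ∃ s : ℕ, d * s ≤ 2 ^ k ∧ 2 ^ k < d * (s + 1) :=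
      ⟨2 ^ k / d, Nat.mul_div_le _ d, Nat.lt_mul_div_succ _ hd0⟩
    have hs3 : s ≤ 2 ^ k := by nlinarith
    have hsZ : (s : ℤ) ≤ 2 ^ k := by exact_mod_cast hs3
    have hs1Z : (d * s : ℤ) ≤ 2 ^ k := by exact_mod_cast hs1
    refine ⟨s, ?_, ?_⟩
    · have g1 : r + 1 ≤ 12 * d * 2 ^ k := by
        have : 2 ^ k ≤ d * 2 ^ k := Nat.le_mul_of_pos_left _ hd0
        linarith
      have g2 : 12 * d * 2 ^ k ≤ 12 * d * (d * (s + 1)) := Nat.mul_le_mul_left _ hs2.le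
      calc r + 1 ≤ _ := g1.trans g2
        _ = _ := by ring
    · refine isoV hd0 i j hij x r k s (cpt d k).1
        (fun l => if l = i then 16 * 2 ^ k - s else 8 * 2 ^ k) ?_ ?_ ?_ ?_
      · intro l
        simp only [cpt]
        constructor <;> linarith
      · intro l
        split_ifs <;> constructor <;> linarith
      · intro y hy
        have g1 := GX_dist_le (cpt d k) y
        have g2 := GY_dist_le i j hij (cpt d k) y
        have g3 := ell_le (cpt d k).1 y.1 s (fun l => by
          have := hy l
          rw [abs_le]; constructor <;> linarith)
        have g4 := hG.dist_triangle (u := x) (v := cpt d k) (w := y)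
        have g5 : ((GX d).dist (cpt d k) y : ℤ) ≤ ((2 ^ k : ℕ) : ℤ) := by push_cast; linarith
        have g6 : (GX d).dist (cpt d k) y ≤ 2 ^ k := by exact_mod_cast g5
        omega
      · intro y hy
        have h1 := hy i
        have h2 := hy j
        simp only [hij.symm, if_true, if_false] at h1 h2
        have hyA : y ∉ AA d k := by
          intro hc
          have := hc i
          linarith
        have h3 := far i j hij k x y hxA hyA
        have h4 := le_abs_self (y.1 i - y.1 j)
        have h5 : (2 * s : ℤ) ≤ d * s := by
          have : (2:ℤ) ≤ d := by exact_mod_cast hd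
          nlinarith
        have : (r : ℤ) < (GY d i j).dist x y := by linarith
        exact_mod_cast this

lemma growth {d : ℕ} (hd : 2 ≤ d) (i j : Fin d) (hij : i ≠ j) (G : SimpleGraph (VV d))
    (h1 : ∀ x r, gBall (GX d) x r ⊆ gBall G x r) (h2 : ∀ x r, gBall G x r ⊆ gBall (GY d i j) x r) :
    PolyGrowth G d := by
  have hdR : (2:ℝ) ≤ d := by exact_mod_cast hd
  refine ⟨(32 * d) ^ d, one_le_pow₀ (by linarith), fun x r hr => ?_⟩
  have hrR : (1:ℝ) ≤ r := by exact_mod_cast hr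
  obtain ⟨hf, hu⟩ := ball_up i j hij x r
  have hf' := hf.subset (h2 x r)
  constructor
  · obtain ⟨s, hs1, hs2⟩ := ball_low i j hij (by omega) x r
    have hs3 := hs2.trans (Set.ncard_le_ncard (h1 x r) hf')
    have hs4 : ((s:ℝ) + 1) ^ d ≤ ((gBall G x r).ncard : ℝ) := by exact_mod_cast hs3
    have hs5 : (r:ℝ) + 1 ≤ 32 * d * (s + 1) := by exact_mod_cast hs1
    rw [inv_mul_le_iff₀ (by positivity)]
    calc (r:ℝ) ^ d ≤ (32 * d * (s + 1)) ^ d := by gcongr; linarith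
      _ = (32 * d) ^ d * ((s:ℝ) + 1) ^ d := by rw [mul_pow]
      _ ≤ _ := by gcongr
  · have h3 := (Set.ncard_le_ncard (h2 x r) hf).trans hu
    have h4 : ((gBall G x r).ncard : ℝ) ≤ (8 * r + 1) ^ d := by exact_mod_cast h3
    calc _ ≤ _ := h4
      _ ≤ ((32 * d) * (r:ℝ)) ^ d := by gcongr; nlinarith
      _ = _ := by rw [mul_pow]

lemma ball_one {V : Type*} {G : SimpleGraph V} {d : ℕ} (h : PolyGrowth G d) :
    ∃ M : ℕ, ∀ x, (gBall G x 1).Finite ∧ (gBall G x 1).ncard ≤ M := by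
  obtain ⟨C, hC, h⟩ := h
  refine ⟨⌈C⌉₊, fun x => ?_⟩
  obtain ⟨h1, h2⟩ := h x 1 le_rfl
  simp only [Nat.cast_one, one_pow, mul_one] at h1 h2
  constructor
  · apply Set.finite_of_ncard_pos
    have : (0:ℝ) < (gBall G x 1).ncard := lt_of_lt_of_le (by positivity) h1
    exact_mod_cast this
  · exact_mod_cast h2.trans (Nat.le_ceil C)

lemma bddDeg {V : Type*} {G : SimpleGraph V} {d : ℕ} (h : PolyGrowth G d) : BddDegree G := by
  obtain ⟨M, hM⟩ := ball_one h
  refine ⟨M, fun v => (Set.ncard_le_ncard (fun w hw => ?_) (hM v).1).trans (hM v).2⟩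
  exact (SimpleGraph.dist_eq_one_iff_adj.2 hw).le

lemma cpt_inj {d : ℕ} (hd : 0 < d) : Function.Injective (cpt d) := by
  intro a b h
  have h1 := congrFun (congrArg Subtype.val h) ⟨0, hd⟩
  simp only [cpt] at h1
  have h2 : (2:ℤ) ^ a = 2 ^ b := by linarith
  exact pow_right_injective₀ (by norm_num) (by norm_num) h2

lemma AA_fin {d : ℕ} (i j : Fin d) (hij : i ≠ j) (n : ℕ) : (AA d n).Finite := by
  rw [AA_eq_ball]
  exact (ball_up i j hij _ _).1.subset (gBall_sub i j hij _ _)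

lemma AA_card {d : ℕ} (hd : 0 < d) (i j : Fin d) (hij : i ≠ j) (n : ℕ) : n ≤ (AA d n).ncard := by
  have h1 : cpt d '' (Set.Iio n) ⊆ AA d n := by
    rintro _ ⟨k, hk, rfl⟩ l
    have : (2:ℤ) ^ k ≤ 2 ^ n := pow_le_pow_right₀ (by norm_num) (le_of_lt hk)
    simp only [cpt]; linarith
  have h2 := Set.ncard_le_ncard h1 (AA_fin i j hij n)
  rwa [Set.ncard_image_of_injective _ (cpt_inj hd), ← Finset.coe_Iio, Set.ncard_coe_finset,
    Nat.card_Iio] at h2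

lemma AA_bdry_bdd {d : ℕ} (G : SimpleGraph (VV d)) (hG : G.Connected) (hp : PolyGrowth G d)
    (hc : ∀ v w, G.Adj v w → ∃ k, v.1 ∈ cube d k ∧ w.1 ∈ cube d k) :
    ∃ M : ℕ, ∀ n, (gBdry G (AA d n)).ncard ≤ M := by
  obtain ⟨M, hM⟩ := ball_one hp
  exact ⟨M, fun n => (Set.ncard_le_ncard (AA_bdry n G hG hc) (hM _).1).trans (hM _).2⟩

lemma prof_bdd {d : ℕ} (hd : 0 < d) (i j : Fin d) (hij : i ≠ j) (G : SimpleGraph (VV d))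
    (hG : G.Connected) (hp : PolyGrowth G d)
    (hc : ∀ v w, G.Adj v w → ∃ k, v.1 ∈ cube d k ∧ w.1 ∈ cube d k) :
    ∃ M : ℕ, ∀ t, gProfile G t ≤ M := by
  obtain ⟨M, hM⟩ := AA_bdry_bdd G hG hp hc
  refine ⟨M, fun t => le_trans (Nat.sInf_le ?_) (hM t)⟩
  exact ⟨AA d t, AA_fin i j hij t, AA_card hd i j hij t, rfl⟩

lemma dist_rev {d : ℕ} (i j : Fin d) (hij : i ≠ j) (x y : VV d) :
    ((GX d).dist x y : ℤ) ≤ 4 * d * (GY d i j).dist x y := by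
  have h1 := GX_dist_le x y
  have h2 := ell_le _ _ _ (GY_coord i j hij x y)
  linarith

lemma final_bound {d : ℕ} (hd : 2 ≤ d) (b bd r s : ℕ) (h1 : r + 1 ≤ 12 * d ^ 2 * (s + 1))
    (h2 : (s + 1) ^ d ≤ bd * (d * (s + 1))) (h3 : b ≤ (8 * r + 1) ^ d) :
    ((96 * (d:ℝ) ^ 2) ^ (d - 1) * d)⁻¹ * (b : ℝ) ^ (((d : ℝ) - 1) / (d : ℝ)) ≤ (bd : ℝ) := by
  have hdR : (2:ℝ) ≤ d := by exact_mod_cast hd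
  rw [inv_mul_le_iff₀ (by positivity)]
  have e1 : (r:ℝ) + 1 ≤ 12 * d ^ 2 * (s + 1) := by exact_mod_cast h1
  have e3 : (b:ℝ) ≤ (8 * r + 1) ^ d := by exact_mod_cast h3
  have e2 : ((s:ℝ) + 1) ^ (d - 1) ≤ bd * d := by
    have h4 : ((s:ℝ) + 1) ^ d ≤ bd * (d * (s + 1)) := by exact_mod_cast h2
    have h5 : ((s:ℝ) + 1) ^ d = ((s:ℝ) + 1) ^ (d - 1) * (s + 1) := by
      rw [← pow_succ]; congr 1; omega
    rw [h5, ← mul_assoc] at h4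
    exact le_of_mul_le_mul_right h4 (by positivity)
  set X : ℝ := 96 * (d:ℝ) ^ 2 * (s + 1) with hX
  have hX0 : 0 ≤ X := by positivity
  have hbX : (b:ℝ) ≤ X ^ d := e3.trans (by gcongr; linarith)
  calc (b : ℝ) ^ (((d : ℝ) - 1) / (d : ℝ)) ≤ (X ^ d) ^ (((d : ℝ) - 1) / (d : ℝ)) := by
        apply Real.rpow_le_rpow (by positivity) hbX
        apply div_nonneg <;> linarith
    _ = X ^ (d - 1) := by
        rw [← Real.rpow_natCast X d, ← Real.rpow_mul hX0, mul_div_cancel₀ _ (by positivity),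
          ← Real.rpow_natCast X (d - 1), Nat.cast_sub (by omega), Nat.cast_one]
    _ = (96 * (d:ℝ) ^ 2) ^ (d - 1) * ((s:ℝ) + 1) ^ (d - 1) := by rw [hX, mul_pow]
    _ ≤ (96 * (d:ℝ) ^ 2) ^ (d - 1) * (bd * d) := by gcongr
    _ = _ := by ring

theorem IB_not_invariant_under_quasi_isometry (d : ℕ) (hd : 2 ≤ d) :
    ∃ (V V' : Type) (G : SimpleGraph V) (G' : SimpleGraph V'),
      Countable V ∧ Infinite V ∧ G.Connected ∧ BddDegree G ∧
      Countable V' ∧ Infinite V' ∧ G'.Connected ∧ BddDegree G' ∧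
      PolyGrowth G d ∧ PolyGrowth G' d ∧
      (∃ M : ℕ, ∀ t : ℕ, gProfile G t ≤ M) ∧
      (∃ M : ℕ, ∀ t : ℕ, gProfile G' t ≤ M) ∧
      (∃ f : V → V', GraphQI G G' f) ∧
      -- in X, there is a sequence of balls of unbounded volume and bounded boundary:
      (∃ (x : ℕ → V) (r : ℕ → ℕ),
        Tendsto (fun n => (gBall G (x n) (r n)).ncard) atTop atTop ∧
        ∃ M : ℕ, ∀ n, (gBdry G (gBall G (x n) (r n))).ncard ≤ M) ∧
      -- in X', every ball satisfies a strong isoperimetric lower bound: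
      (∃ c : ℝ, 0 < c ∧ ∀ (x : V') (r : ℕ),
        c * ((gBall G' x r).ncard : ℝ) ^ (((d : ℝ) - 1) / (d : ℝ)) ≤
          ((gBdry G' (gBall G' x r)).ncard : ℝ)) := by

  have hd0 : 0 < d := by omega
  obtain ⟨i, j, hij⟩ : ∃ i j : Fin d, i ≠ j :=
    ⟨⟨0, by omega⟩, ⟨1, by omega⟩, fun h => by simp at h⟩
  have hX := GX_conn d
  have hY := GY_conn d i j hij
  have pX : PolyGrowth (GX d) d :=
    growth hd i j hij _ (fun _ _ => subset_rfl) (fun x r => gBall_sub i j hij x r)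
  have pY : PolyGrowth (GY d i j) d :=
    growth hd i j hij _ (fun x r => gBall_sub i j hij x r) (fun _ _ => subset_rfl)
  have hinf : Infinite (VV d) := Infinite.of_injective _ (cpt_inj hd0)
  have cX : ∀ v w, (GX d).Adj v w → ∃ k, v.1 ∈ cube d k ∧ w.1 ∈ cube d k := fun v w h => h.1
  have cY : ∀ v w, (GY d i j).Adj v w → ∃ k, v.1 ∈ cube d k ∧ w.1 ∈ cube d k := fun v w h => h.2.1
  refine ⟨VV d, VV d, GX d, GY d i j, inferInstance, hinf, hX, bddDeg pX, inferInstance, hinf, hY,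
    bddDeg pY, pX, pY, prof_bdd hd0 i j hij _ hX pX cX, prof_bdd hd0 i j hij _ hY pY cY,
    ⟨id, ?_⟩, ?_, ?_⟩
  · have hdR : (2:ℝ) ≤ d := by exact_mod_cast hd
    refine ⟨1, one_pos, 4 * d, by linarith, fun y => ⟨y, by simp⟩, fun x y => ⟨?_, ?_⟩⟩
    · have h1 : ((GX d).dist x y : ℝ) ≤ 4 * d * (GY d i j).dist x y := by
        exact_mod_cast dist_rev i j hij x y
      have h2 : (4 * (d:ℝ))⁻¹ * (GX d).dist x y ≤ (GY d i j).dist x y := by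
        rw [inv_mul_le_iff₀ (by positivity)]; exact h1
      simp only [id]
      linarith
    · have h1 : ((GY d i j).dist x y : ℝ) ≤ (GX d).dist x y := by
        exact_mod_cast GY_dist_le i j hij x y
      have h2 : (0:ℝ) ≤ (GX d).dist x y := by positivity
      simp only [id]
      nlinarith
  · refine ⟨fun _ => cpt d 0, fun n => d * (8 * 2 ^ n - 8), ?_, ?_⟩
    · simp only [← AA_eq_ball]
      exact tendsto_atTop_mono (AA_card hd0 i j hij) tendsto_id
    · simp only [← AA_eq_ball]
      exact AA_bdry_bdd _ hX pX cX
  · refine ⟨((96 * (d:ℝ) ^ 2) ^ (d - 1) * d)⁻¹, by positivity, fun x r => ?_⟩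
    obtain ⟨s, h1, h2⟩ := main_low hd i j hij x r
    exact final_bound hd _ _ r s h1 h2 (ball_up i j hij x r).2
end
end
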